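/- arXiv:2111.12662 — 2 statements merged into one kernel-verified Lean document; each statement's English description precedes it below -/
import Mathlib

section
/- Let χ be a Dirichlet character modulo q. Then for Re s > 1, F(s,χ) = √(L(s,χ)L(s,χχ₋₄)) · (L(2s,χ²)/L(2s,χ²χ₋₄))^{1/4} · G(s,χ), where G(·,χ) extends to a function analytic and non-vanishing in Re s > 1/4 and bounded in Re s ≥ 1/4 + ε for each ε > 0. Moreover, if χ is real then G(1/2,χ) = (1 − χ(2)/√2)^{−1/2} · (1 − 𝟙[2∤q]/2)^{1/4} · ∏_{p ≡ 3 mod 4, p ∤ q} (1 − p^{−2})^{−1/4}. -/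
open Complex Filter
open scoped Classical

noncomputable section

/-- `n` is a sum of two squares. -/
def IsSum2Sq (n : ℕ) : Prop := ∃ a b : ℕ, n = a ^ 2 + b ^ 2

/-- The Dirichlet L-function `L(s,χ)` (junk value `0` if the modulus is `0`). -/
noncomputable def LVal {N : ℕ} (χ : DirichletCharacter ℂ N) (s : ℂ) : ℂ :=
  if h : N = 0 then 0 else
    haveI : NeZero N := ⟨h⟩
    DirichletCharacter.LFunction χ s

/-- GRH for `L(s,χ)`: all zeros with `0 < Re s < 1` have real part `1/2`. -/
def GRH {N : ℕ} (χ : DirichletCharacter ℂ N) : Prop :=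
  ∀ s : ℂ, 0 < s.re → s.re < 1 → LVal χ s = 0 → s.re = 1 / 2

/-- The unique non-principal Dirichlet character modulo 4. -/
noncomputable def chiNeg4 : DirichletCharacter ℂ 4 := ZMod.χ₄.ringHomComp (Int.castRingHom ℂ)

/-- The product `χ ⋅ χ₋₄`, as a Dirichlet character modulo `4q`. -/
noncomputable def mulChiNeg4 {q : ℕ} (χ : DirichletCharacter ℂ q) : DirichletCharacter ℂ (4 * q) :=
  DirichletCharacter.changeLevel (dvd_mul_left q 4) χ *
    DirichletCharacter.changeLevel (dvd_mul_right 4 q) chiNeg4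

/-- `S(x;q,a)`, the number of sums of two squares `n ≤ x` with `n ≡ a (mod q)`. -/
noncomputable def Scount (q a : ℕ) (x : ℝ) : ℕ :=
  ((Finset.Icc 1 ⌊x⌋₊).filter (fun m => IsSum2Sq m ∧ (m : ZMod q) = (a : ZMod q))).card

/-- The sequence `n ↦ 1_S(n) χ(n)`. -/
noncomputable def STwist {q : ℕ} (χ : DirichletCharacter ℂ q) (n : ℕ) : ℂ :=
  if IsSum2Sq n then χ (n : ZMod q) else 0

/-- `∑_{n ≤ x, n ∈ S} χ(n)`. -/
noncomputable def SSum {q : ℕ} (χ : DirichletCharacter ℂ q) (x : ℝ) : ℂ :=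
  ∑ n ∈ Finset.Icc 1 ⌊x⌋₊, STwist χ n

/-- A set of positive integers has natural density one. -/
def HasDensityOne (P : ℕ → Prop) : Prop :=
  Tendsto (fun n : ℕ => (((Finset.Icc 1 n).filter P).card : ℝ) / n) atTop (nhds 1)

/-- The integral of `f` over the truncated Hankel contour around `ρ`, with horizontal extent
`c` and radius `r`; the two horizontal segments are taken as boundary values from below
(lower segment, traversed rightwards, `arg(s-ρ) = -π`) and from above (upper segment,
traversed leftwards, `arg(s-ρ) = π`), and the circle `|s-ρ| = r` is traversed
anticlockwise. -/
noncomputable def hankelIntegral (f : ℂ → ℂ) (ρ : ℂ) (c r : ℝ) : ℂ :=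
  limUnder (nhdsWithin (0 : ℝ) (Set.Ioi 0)) (fun ε =>
    ((∫ σ in (ρ.re - c)..(ρ.re - r), f (σ + (ρ.im - ε) * I))
      + ∫ θ in (-Real.pi)..Real.pi, f (ρ + r * Complex.exp (θ * I)) * (I * r * Complex.exp (θ * I)))
      - ∫ σ in (ρ.re - c)..(ρ.re - r), f (σ + (ρ.im + ε) * I))

/-- The integral `∫ g(s) |ds|` of a nonnegative density `g` over the truncated Hankel
contour around `ρ` (horizontal extent `c`, radius `r`), horizontal segments again taken
as boundary values from below resp. above. -/
noncomputable def hankelAbsIntegral (g : ℂ → ℝ) (ρ : ℂ) (c r : ℝ) : ℝ :=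
  limUnder (nhdsWithin (0 : ℝ) (Set.Ioi 0)) (fun ε =>
    (∫ σ in (ρ.re - c)..(ρ.re - r), g (σ + (ρ.im - ε) * I))
      + (∫ θ in (-Real.pi)..Real.pi, g (ρ + r * Complex.exp (θ * I)) * r)
      + ∫ σ in (ρ.re - c)..(ρ.re - r), g (σ + (ρ.im + ε) * I))

/-- The constant `C_q` of the paper. -/
noncomputable def Cconst (q : ℕ) : ℝ :=
  (2 * Real.pi ^ (-(1 / 4 : ℝ)) / Real.Gamma (1 / 4)) *
    (∏' p : Nat.Primes, if (p : ℕ) % 4 = 3 then (1 - (p : ℝ) ^ (-(2:ℝ))) ^ (-(1 / 4 : ℝ)) else 1) *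
    ∏ p ∈ q.primeFactors.filter (fun p => p % 4 = 3), (1 - 1 / (p : ℝ)) ^ ((1 : ℝ) / 2)

/-! ### Sums of two squares -/

lemma isSum2Sq_iff {n : ℕ} :
    IsSum2Sq n ↔ ∀ p ∈ n.primeFactors, p % 4 = 3 → Even (padicValNat p n) :=
  Nat.eq_sq_add_sq_iff

lemma isSum2Sq_mul_iff {m n : ℕ} (h : m.Coprime n) :
    IsSum2Sq (m * n) ↔ IsSum2Sq m ∧ IsSum2Sq n := by
  rcases Nat.eq_zero_or_pos m with rfl | hm
  · obtain rfl : n = 1 := by simpa using h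
    exact ⟨fun _ => ⟨⟨0, 0, rfl⟩, ⟨1, 0, rfl⟩⟩, fun _ => ⟨0, 0, rfl⟩⟩
  rcases Nat.eq_zero_or_pos n with rfl | hn
  · obtain rfl : m = 1 := by simpa using h
    exact ⟨fun _ => ⟨⟨1, 0, rfl⟩, ⟨0, 0, rfl⟩⟩, fun _ => ⟨0, 0, rfl⟩⟩
  simp only [isSum2Sq_iff, h.primeFactors_mul, Finset.mem_union]
  have key : ∀ p, p.Prime → padicValNat p (m * n) = padicValNat p m + padicValNat p n := by
    intro p hp
    have := Fact.mk hp
    exact padicValNat.mul hm.ne' hn.ne'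
  have hl : ∀ p ∈ m.primeFactors, padicValNat p n = 0 := fun p hp =>
    padicValNat.eq_zero_of_not_dvd fun hd => (Nat.prime_of_mem_primeFactors hp).one_lt.ne'
      (Nat.eq_one_of_dvd_coprimes h (Nat.dvd_of_mem_primeFactors hp) hd)
  have hr : ∀ p ∈ n.primeFactors, padicValNat p m = 0 := fun p hp =>
    padicValNat.eq_zero_of_not_dvd fun hd => (Nat.prime_of_mem_primeFactors hp).one_lt.ne'
      (Nat.eq_one_of_dvd_coprimes h hd (Nat.dvd_of_mem_primeFactors hp))
  constructor
  · intro H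
    refine ⟨fun p hp h3 => ?_, fun p hp h3 => ?_⟩
    · simpa [key p (Nat.prime_of_mem_primeFactors hp), hl p hp] using H p (Or.inl hp) h3
    · simpa [key p (Nat.prime_of_mem_primeFactors hp), hr p hp] using H p (Or.inr hp) h3
  · rintro ⟨h1, h2⟩ p (hp | hp) h3
    · simpa [key p (Nat.prime_of_mem_primeFactors hp), hl p hp] using h1 p hp h3
    · simpa [key p (Nat.prime_of_mem_primeFactors hp), hr p hp] using h2 p hp h3

lemma isSum2Sq_prime_pow_iff {p : ℕ} (hp : p.Prime) (e : ℕ) :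
    IsSum2Sq (p ^ e) ↔ (p % 4 = 3 → Even e) := by
  have := Fact.mk hp
  rw [isSum2Sq_iff]
  rcases eq_or_ne e 0 with rfl | he
  · simp
  · simp [Nat.primeFactors_prime_pow he hp]

/-! ### Values at primes -/

lemma mulChiNeg4_apply {q : ℕ} (χ : DirichletCharacter ℂ q) (n : ℕ) :
    mulChiNeg4 χ n = χ n * chiNeg4 n := by
  by_cases hn : n.Coprime (4 * q)
  · have hc : IsCoprime (n : ℤ) ((4 * q : ℕ) : ℤ) := Nat.isCoprime_iff_coprime.mpr hn
    have h1 := DirichletCharacter.changeLevel_eq_cast_of_dvd' χ (dvd_mul_left q 4) hc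
    have h2 := DirichletCharacter.changeLevel_eq_cast_of_dvd' chiNeg4 (dvd_mul_right 4 q) hc
    push_cast at h1 h2
    rw [mulChiNeg4, MulChar.mul_apply, h1, h2]
  · have hu : ¬ IsUnit (n : ZMod (4 * q)) := by rwa [ZMod.isUnit_iff_coprime]
    rw [MulChar.map_nonunit _ hu]
    symm
    by_contra hne
    refine hn (Nat.Coprime.mul_right ?_ ?_) <;> rw [← ZMod.isUnit_iff_coprime] <;> by_contra hu'
    · exact hne (by rw [MulChar.map_nonunit chiNeg4 hu', mul_zero])
    · exact hne (by rw [MulChar.map_nonunit χ hu', zero_mul])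

lemma chiNeg4_apply (n : ℕ) :
    chiNeg4 n = if n % 2 = 0 then 0 else if n % 4 = 1 then 1 else -1 := by
  rw [chiNeg4, MulChar.ringHomComp_apply, ZMod.χ₄_nat_eq_if_mod_four]
  split_ifs <;> simp

lemma natCast_cpow_neg_two_mul (n : ℕ) (s : ℂ) :
    (n : ℂ) ^ (-(2 * s)) = ((n : ℂ) ^ (-s)) ^ 2 := by
  rw [show -(2 * s) = (2 : ℕ) * (-s) by push_cast; ring, cpow_nat_mul]

lemma natCast_cpow_neg_four_mul (n : ℕ) (s : ℂ) :
    (n : ℂ) ^ (-(4 * s)) = ((n : ℂ) ^ (-s)) ^ 4 := by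
  rw [show -(4 * s) = (4 : ℕ) * (-s) by push_cast; ring, cpow_nat_mul]

lemma norm_mul_natCast_cpow_neg_le {c : ℂ} (hc : ‖c‖ ≤ 1) {n : ℕ} (hn : 0 < n) (s : ℂ) :
    ‖c * (n : ℂ) ^ (-s)‖ ≤ (n : ℝ) ^ (-s.re) := by
  rw [norm_mul, norm_natCast_cpow_of_pos hn, neg_re]
  exact mul_le_of_le_one_left (by positivity) hc

lemma norm_mul_natCast_cpow_neg_lt_one {c : ℂ} (hc : ‖c‖ ≤ 1) {n : ℕ} (hn : 1 < n) {s : ℂ}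
    (hs : 0 < s.re) : ‖c * (n : ℂ) ^ (-s)‖ < 1 :=
  (norm_mul_natCast_cpow_neg_le hc (by lia) s).trans_lt
    (Real.rpow_lt_one_of_one_lt_of_neg (by exact_mod_cast hn) (by linarith))

/-! ### Euler products -/

lemma LVal_hasProd {N : ℕ} (hN : 0 < N) (χ : DirichletCharacter ℂ N) {s : ℂ} (hs : 1 < s.re) :
    HasProd (fun p : Nat.Primes => (1 - χ (p : ℕ) * ((p : ℕ) : ℂ) ^ (-s))⁻¹) (LVal χ s) := by
  have : NeZero N := ⟨hN.ne'⟩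
  rw [LVal, dif_neg hN.ne', DirichletCharacter.LFunction_eq_LSeries χ hs]
  exact DirichletCharacter.LSeries_eulerProduct_hasProd χ hs

lemma STwist_norm_le_one {q : ℕ} (χ : DirichletCharacter ℂ q) (n : ℕ) : ‖STwist χ n‖ ≤ 1 := by
  unfold STwist
  split_ifs
  · exact χ.norm_le_one _
  · simp

lemma STwist_mul {q : ℕ} (χ : DirichletCharacter ℂ q) {m n : ℕ} (h : m.Coprime n) :
    STwist χ (m * n) = STwist χ m * STwist χ n := by
  simp only [STwist, isSum2Sq_mul_iff h]
  by_cases hm : IsSum2Sq m <;> by_cases hn : IsSum2Sq n <;> simp [hm, hn]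

lemma hasSum_ite_even_pow {z : ℂ} (hz : ‖z‖ < 1) :
    HasSum (fun e : ℕ => if Even e then z ^ e else 0) (1 - z ^ 2)⁻¹ := by
  have hz2 : ‖z ^ 2‖ < 1 := by
    rw [norm_pow]; exact pow_lt_one₀ (norm_nonneg z) hz two_ne_zero
  have hinj : Function.Injective (fun k : ℕ => 2 * k) := fun a b h => by simpa using h
  rw [← hinj.hasSum_iff]
  · have hcomp : (fun e : ℕ => if Even e then z ^ e else 0) ∘ (fun k => 2 * k) =
        fun k => (z ^ 2) ^ k := by
      ext k
      simp [pow_mul]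
    rw [hcomp]
    exact hasSum_geometric_of_norm_lt_one hz2
  · intro e he
    rw [if_neg]
    rintro ⟨k, rfl⟩
    exact he ⟨k, two_mul k⟩

lemma term_STwist_prime_pow {q : ℕ} (χ : DirichletCharacter ℂ q) (s : ℂ) {p : ℕ} (hp : p.Prime)
    (e : ℕ) : LSeries.term (STwist χ) s (p ^ e) =
      if p % 4 = 3 → Even e then (χ p * (p : ℂ) ^ (-s)) ^ e else 0 := by
  rw [LSeries.term_of_ne_zero (pow_ne_zero _ hp.ne_zero), STwist]
  simp only [isSum2Sq_prime_pow_iff hp]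
  split_ifs
  · rw [mul_pow, div_eq_mul_inv, ← cpow_neg, Nat.cast_pow, Nat.cast_pow, map_pow,
      ← natCast_cpow_natCast_mul, cpow_nat_mul]
  · simp

lemma tsum_term_STwist_prime_pow {q : ℕ} (χ : DirichletCharacter ℂ q) {s : ℂ} (hs : 0 < s.re)
    {p : ℕ} (hp : p.Prime) : ∑' e, LSeries.term (STwist χ) s (p ^ e) =
      if p % 4 = 3 then (1 - (χ p * (p : ℂ) ^ (-s)) ^ 2)⁻¹ else (1 - χ p * (p : ℂ) ^ (-s))⁻¹ := by
  have hz := norm_mul_natCast_cpow_neg_lt_one (χ.norm_le_one (p : ZMod q)) hp.one_lt hs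
  simp only [term_STwist_prime_pow χ s hp]
  split_ifs with h
  · simpa [h] using (hasSum_ite_even_pow hz).tsum_eq
  · simpa [h] using tsum_geometric_of_norm_lt_one hz

lemma LSeries_STwist_hasProd {q : ℕ} (χ : DirichletCharacter ℂ q) {s : ℂ} (hs : 1 < s.re) :
    HasProd (fun p : Nat.Primes => if (p : ℕ) % 4 = 3
        then (1 - (χ (p : ℕ) * ((p : ℕ) : ℂ) ^ (-s)) ^ 2)⁻¹
        else (1 - χ (p : ℕ) * ((p : ℕ) : ℂ) ^ (-s))⁻¹) (LSeries (STwist χ) s) := by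
  have hsum : LSeriesSummable (STwist χ) s :=
    LSeriesSummable_of_bounded_of_one_lt_re (fun n _ => STwist_norm_le_one χ n) hs
  have h := EulerProduct.eulerProduct_hasProd (f := LSeries.term (STwist χ) s) ?_ ?_ hsum.norm
    (LSeries.term_zero _ _)
  · rwa [funext fun p : Nat.Primes =>
      tsum_term_STwist_prime_pow χ (one_pos.trans hs) p.prop] at h
  · have : IsSum2Sq 1 := ⟨1, 0, rfl⟩
    simp [LSeries.term_of_ne_zero, STwist, this]
  · intro m n hmn
    rcases eq_or_ne m 0 with rfl | hm
    · simp
    rcases eq_or_ne n 0 with rfl | hn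
    · simp
    rw [LSeries.term_of_ne_zero hm, LSeries.term_of_ne_zero hn,
      LSeries.term_of_ne_zero (mul_ne_zero hm hn), STwist_mul χ hmn, Nat.cast_mul,
      natCast_mul_natCast_cpow, mul_div_mul_comm]

/-! ### Logarithms of Euler factors -/

/-- The logarithm `log (1 - c n^{-s})` of the inverse of an Euler factor. -/
def eulerLog (c : ℂ) (n : ℕ) (s : ℂ) : ℂ := Complex.log (1 - c * (n : ℂ) ^ (-s))

lemma exp_eulerLog {c : ℂ} (hc : ‖c‖ ≤ 1) {n : ℕ} (hn : 1 < n) {s : ℂ} (hs : 0 < s.re) :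
    Complex.exp (eulerLog c n s) = 1 - c * (n : ℂ) ^ (-s) := by
  refine Complex.exp_log fun h => ?_
  have := norm_mul_natCast_cpow_neg_lt_one hc hn hs
  rw [← sub_eq_zero.mp h, norm_one] at this
  exact lt_irrefl _ this

lemma differentiableOn_eulerLog {c : ℂ} (hc : ‖c‖ ≤ 1) {n : ℕ} (hn : 1 < n) :
    DifferentiableOn ℂ (eulerLog c n) {s | 0 < s.re} := by
  intro s hs
  have hn0 : (n : ℂ) ≠ 0 := by exact_mod_cast (by lia : n ≠ 0)
  refine (DifferentiableAt.clog (by fun_prop (disch := simp [hn0])) ?_).differentiableWithinAt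
  rw [sub_eq_add_neg]
  refine mem_slitPlane_of_norm_lt_one ?_
  rw [norm_neg]
  exact norm_mul_natCast_cpow_neg_lt_one hc hn hs

lemma norm_eulerLog_le {c : ℂ} (hc : ‖c‖ ≤ 1) {n : ℕ} (hn : 1 < n) {δ : ℝ} (hδ : 0 < δ) {s : ℂ}
    (hs : δ ≤ s.re) : ‖eulerLog c n s‖ ≤ (1 - (n : ℝ) ^ (-δ))⁻¹ / 2 + 1 := by
  have h1n : (1 : ℝ) < n := by exact_mod_cast hn
  have hδ1 : (n : ℝ) ^ (-δ) < 1 := Real.rpow_lt_one_of_one_lt_of_neg h1n (by linarith)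
  have hz : ‖-(c * (n : ℂ) ^ (-s))‖ ≤ (n : ℝ) ^ (-δ) := by
    rw [norm_neg]
    exact (norm_mul_natCast_cpow_neg_le hc (by lia) s).trans
      (Real.rpow_le_rpow_of_exponent_le h1n.le (by linarith))
  have h := norm_log_one_add_le (hz.trans_lt hδ1)
  rw [eulerLog, sub_eq_add_neg]
  refine h.trans ?_
  have h1 : ‖-(c * (n : ℂ) ^ (-s))‖ ^ 2 ≤ 1 := pow_le_one₀ (norm_nonneg _) (hz.trans hδ1.le)
  have h2 : (1 - ‖-(c * (n : ℂ) ^ (-s))‖)⁻¹ ≤ (1 - (n : ℝ) ^ (-δ))⁻¹ :=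
    inv_anti₀ (by linarith) (by linarith)
  have h3 : 0 ≤ (1 - ‖-(c * (n : ℂ) ^ (-s))‖)⁻¹ := inv_nonneg.mpr (by linarith)
  nlinarith [mul_le_mul_of_nonneg_right h1 h3]

lemma norm_eulerLog_le_rpow {c : ℂ} (hc : ‖c‖ ≤ 1) {n : ℕ} (hn : 1 < n) {δ : ℝ} (hδ : 1 ≤ δ)
    {s : ℂ} (hs : δ ≤ s.re) : ‖eulerLog c n s‖ ≤ 3 / 2 * (n : ℝ) ^ (-δ) := by
  have h1n : (1 : ℝ) < n := by exact_mod_cast hn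
  have h2n : (2 : ℝ) ≤ n := by exact_mod_cast hn
  have hz : ‖-(c * (n : ℂ) ^ (-s))‖ ≤ (n : ℝ) ^ (-δ) := by
    rw [norm_neg]
    exact (norm_mul_natCast_cpow_neg_le hc (by lia) s).trans
      (Real.rpow_le_rpow_of_exponent_le h1n.le (by linarith))
  have hhalf : (n : ℝ) ^ (-δ) ≤ 1 / 2 := by
    refine (Real.rpow_le_rpow_of_exponent_le h1n.le (by linarith : -δ ≤ -1)).trans ?_
    rw [Real.rpow_neg_one, one_div]
    exact inv_anti₀ two_pos h2n
  rw [eulerLog, sub_eq_add_neg]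
  exact (norm_log_one_add_half_le_self (hz.trans hhalf)).trans (by gcongr)

lemma tendsto_eulerLog {c : ℂ} (hc : ‖c‖ ≤ 1) {n : ℕ} (hn : 1 < n) {k : ℝ} (hk : 0 < k) :
    Tendsto (fun σ : ℝ => eulerLog c n (k * (σ : ℂ))) atTop (nhds 0) := by
  have h0 : Tendsto (fun σ : ℝ => c * (n : ℂ) ^ (-(k * (σ : ℂ)))) atTop (nhds 0) := by
    refine squeeze_zero_norm (a := fun σ : ℝ => (n : ℝ) ^ (-(k * σ))) (fun σ => ?_) ?_
    · simpa using norm_mul_natCast_cpow_neg_le hc (by lia : 0 < n) (k * (σ : ℂ))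
    · have h1n : (1 : ℝ) < n := by exact_mod_cast hn
      exact (tendsto_rpow_atBot_of_base_gt_one _ h1n).comp
        (tendsto_neg_atTop_atBot.comp (tendsto_id.const_mul_atTop hk))
  have h1 := (h0.const_sub 1).clog (by simp)
  simpa [eulerLog] using h1

lemma eulerLog_ofReal {c x : ℝ} (hc : |c| ≤ 1) {n : ℕ} (hn : 1 < n) (hx : 0 < x) :
    0 < 1 - c * (n : ℝ) ^ (-x) ∧
      eulerLog c n x = (Real.log (1 - c * (n : ℝ) ^ (-x)) : ℝ) := by
  have h := norm_mul_natCast_cpow_neg_lt_one (c := c) (by simpa using hc) hn (s := x) (by simpa)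
  have he : (c : ℂ) * (n : ℂ) ^ (-(x : ℂ)) = ((c * (n : ℝ) ^ (-x) : ℝ) : ℂ) := by
    rw [ofReal_mul, ofReal_cpow (by positivity)]
    push_cast
    rfl
  rw [he, norm_real, Real.norm_eq_abs, abs_lt] at h
  have hpos : 0 < 1 - c * (n : ℝ) ^ (-x) := by linarith
  refine ⟨hpos, ?_⟩
  rw [eulerLog, he, ofReal_log hpos.le]
  push_cast
  rfl

/-! ### The correction factor -/

/-- The contribution of the prime `p` to the logarithm of the correction factor, for odd `p`. -/
def oddLog {q : ℕ} (χ : DirichletCharacter ℂ q) (p : ℕ) (s : ℂ) : ℂ :=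
  if p % 4 = 3 then -(1 / 4) * eulerLog (χ p ^ 4) p (4 * s) else 0

/-- The contribution of the prime `2` to the logarithm of the correction factor. -/
def twoLog {q : ℕ} (χ : DirichletCharacter ℂ q) (s : ℂ) : ℂ :=
  -(1 / 2) * eulerLog (χ 2) 2 s + 1 / 4 * eulerLog (χ 2 ^ 2) 2 (2 * s)

/-- The factor `G(s, χ)`. -/
def correction {q : ℕ} (χ : DirichletCharacter ℂ q) (s : ℂ) : ℂ :=
  Complex.exp (twoLog χ s + ∑' p : Nat.Primes, oddLog χ p s)

section

variable {q : ℕ} (χ : DirichletCharacter ℂ q)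

lemma norm_apply_pow_le_one (n : ZMod q) (k : ℕ) : ‖χ n ^ k‖ ≤ 1 := by
  rw [norm_pow]
  exact pow_le_one₀ (norm_nonneg _) (χ.norm_le_one n)

lemma norm_oddLog_le {ε : ℝ} (hε : 0 < ε) {p : ℕ} (hp : 1 < p) {s : ℂ} (hs : 1 / 4 + ε ≤ s.re) :
    ‖oddLog χ p s‖ ≤ (p : ℝ) ^ (-(1 + 4 * ε)) := by
  have h0 : (0 : ℝ) ≤ (p : ℝ) ^ (-(1 + 4 * ε)) := by positivity
  unfold oddLog
  split_ifs
  · have h := norm_eulerLog_le_rpow (norm_apply_pow_le_one χ p 4) hp (δ := 1 + 4 * ε)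
      (by linarith) (s := 4 * s) (by simp; linarith)
    rw [norm_mul, norm_neg, show ‖(1 / 4 : ℂ)‖ = 1 / 4 by norm_num]
    linarith
  · simpa using h0

lemma summable_primes_rpow {ε : ℝ} (hε : 0 < ε) :
    Summable (fun p : Nat.Primes => ((p : ℕ) : ℝ) ^ (-(1 + 4 * ε))) :=
  Nat.Primes.summable_rpow.mpr (by linarith)

lemma summable_oddLog {s : ℂ} (hs : 1 / 4 < s.re) :
    Summable (fun p : Nat.Primes => oddLog χ p s) :=
  .of_norm_bounded (summable_primes_rpow (ε := s.re - 1 / 4) (by linarith)) fun p =>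
    norm_oddLog_le χ (by linarith) p.prop.one_lt (by linarith)

lemma differentiableOn_oddLog {p : ℕ} (hp : 1 < p) :
    DifferentiableOn ℂ (oddLog χ p) {s | 0 < s.re} := by
  unfold oddLog
  split_ifs
  · refine DifferentiableOn.const_mul ?_ _
    exact (differentiableOn_eulerLog (norm_apply_pow_le_one χ p 4) hp).comp
      (differentiable_id.const_mul 4).differentiableOn (fun s hs => by simpa using hs)
  · fun_prop

lemma differentiableOn_twoLog : DifferentiableOn ℂ (twoLog χ) {s | 0 < s.re} := by
  refine .add (.const_mul (differentiableOn_eulerLog (χ.norm_le_one 2) one_lt_two) _)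
    (.const_mul ?_ _)
  exact (differentiableOn_eulerLog (norm_apply_pow_le_one χ 2 2) one_lt_two).comp
    (differentiable_id.const_mul 2).differentiableOn (fun s hs => by simpa using hs)

lemma differentiableOn_correction :
    DifferentiableOn ℂ (correction χ) {s : ℂ | 1 / 4 < s.re} := by
  intro s hs
  have hs : 1 / 4 < s.re := hs
  obtain ⟨ε, hε, hεs⟩ : ∃ ε : ℝ, 0 < ε ∧ 1 / 4 + ε < s.re :=
    ⟨(s.re - 1 / 4) / 2, by linarith, by linarith⟩
  have hopen : IsOpen {w : ℂ | 1 / 4 + ε < w.re} := isOpen_lt continuous_const continuous_re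
  have hsub : {w : ℂ | 1 / 4 + ε < w.re} ⊆ {w | 0 < w.re} := fun w (hw : 1 / 4 + ε < w.re) => by
    simp only [Set.mem_ofPred_eq]; linarith
  have hsum := differentiableOn_tsum_of_summable_norm (summable_primes_rpow hε)
    (fun p => (differentiableOn_oddLog χ p.prop.one_lt).mono hsub) hopen
    (fun p w hw => norm_oddLog_le χ hε p.prop.one_lt (le_of_lt hw))
  exact ((((differentiableOn_twoLog χ).mono hsub).add hsum).cexp.differentiableAt
    (hopen.mem_nhds hεs)).differentiableWithinAt

lemma norm_twoLog_le {δ : ℝ} (hδ : 0 < δ) {s : ℂ} (hs : δ ≤ s.re) :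
    ‖twoLog χ s‖ ≤ 1 / 2 * ((1 - ((2 : ℕ) : ℝ) ^ (-δ))⁻¹ / 2 + 1) +
      1 / 4 * ((1 - ((2 : ℕ) : ℝ) ^ (-(2 * δ)))⁻¹ / 2 + 1) := by
  have h1 := norm_eulerLog_le (χ.norm_le_one 2) one_lt_two hδ hs
  have h2 := norm_eulerLog_le (norm_apply_pow_le_one χ 2 2) one_lt_two (δ := 2 * δ) (by linarith)
    (s := 2 * s) (by simpa using hs)
  refine (norm_add_le _ _).trans ?_
  rw [norm_mul, norm_mul, norm_neg]
  norm_num at h1 h2 ⊢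
  linarith

lemma norm_correction_le {ε : ℝ} (hε : 0 < ε) :
    ∃ M : ℝ, ∀ s : ℂ, 1 / 4 + ε ≤ s.re → ‖correction χ s‖ ≤ M := by
  have h14 : 0 < 1 / 4 + ε := by linarith
  refine ⟨Real.exp (1 / 2 * ((1 - ((2 : ℕ) : ℝ) ^ (-(1 / 4 + ε)))⁻¹ / 2 + 1) +
    1 / 4 * ((1 - ((2 : ℕ) : ℝ) ^ (-(2 * (1 / 4 + ε))))⁻¹ / 2 + 1) +
    ∑' p : Nat.Primes, ((p : ℕ) : ℝ) ^ (-(1 + 4 * ε))), fun s hs => ?_⟩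
  rw [correction, norm_exp]
  have hodd := tsum_of_norm_bounded (summable_primes_rpow hε).hasSum
    fun p => norm_oddLog_le χ hε p.prop.one_lt hs
  have htwo := norm_twoLog_le χ h14 hs
  exact Real.exp_le_exp.mpr ((re_le_norm _).trans ((norm_add_le _ _).trans (by gcongr)))

lemma tendsto_oddLog {p : ℕ} (hp : 1 < p) :
    Tendsto (fun σ : ℝ => oddLog χ p (σ : ℂ)) atTop (nhds 0) := by
  unfold oddLog
  split_ifs
  · have h := (tendsto_eulerLog (norm_apply_pow_le_one χ p 4) hp (k := 4)
      (by norm_num)).const_mul (-(1 / 4))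
    rw [mul_zero] at h
    push_cast at h
    exact h
  · exact tendsto_const_nhds

lemma tendsto_twoLog : Tendsto (fun σ : ℝ => twoLog χ (σ : ℂ)) atTop (nhds 0) := by
  have h1 := tendsto_eulerLog (χ.norm_le_one 2) one_lt_two (k := 1) one_pos
  have h2 := tendsto_eulerLog (norm_apply_pow_le_one χ 2 2) one_lt_two (k := 2) two_pos
  have h := (h1.const_mul (-(1 / 2))).add (h2.const_mul (1 / 4))
  simp only [mul_zero, add_zero, ofReal_one, one_mul, ofReal_ofNat] at h
  exact h

lemma tendsto_correction : Tendsto (fun σ : ℝ => correction χ (σ : ℂ)) atTop (nhds 1) := by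
  have h3 : Tendsto (fun σ : ℝ => ∑' p : Nat.Primes, oddLog χ p (σ : ℂ)) atTop
      (nhds (∑' _ : Nat.Primes, 0)) := by
    refine tendsto_tsum_of_dominated_convergence (summable_primes_rpow one_pos)
      (fun p => tendsto_oddLog χ p.prop.one_lt) ?_
    filter_upwards [eventually_ge_atTop (1 / 4 + 1 : ℝ)] with σ hσ p
    exact norm_oddLog_le χ one_pos p.prop.one_lt (by simpa using hσ)
  have h := ((tendsto_twoLog χ).add h3).cexp
  rw [tsum_zero, add_zero, Complex.exp_zero] at h
  exact h

/-- The local factor at `p` of the fourth power of the correction factor, in terms of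
`z = χ(p) p^{-s}`. -/
def localFactor (p : ℕ) (z : ℂ) : ℂ :=
  if p % 4 = 3 then (1 - z ^ 4)⁻¹ else if p = 2 then (1 - z)⁻¹ ^ 2 * (1 - z ^ 2) else 1

lemma exp_four_mul_oddLog {p : ℕ} (hp : 1 < p) {s : ℂ} (hs : 0 < s.re) :
    Complex.exp (4 * oddLog χ p s) =
      if p % 4 = 3 then (1 - (χ p * (p : ℂ) ^ (-s)) ^ 4)⁻¹ else 1 := by
  unfold oddLog
  split_ifs
  · rw [← mul_assoc, show (4 : ℂ) * -(1 / 4) = -1 by norm_num, neg_one_mul, Complex.exp_neg,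
      exp_eulerLog (norm_apply_pow_le_one χ p 4) hp (by simpa using hs),
      natCast_cpow_neg_four_mul, mul_pow]
  · simp

lemma exp_four_mul_twoLog {s : ℂ} (hs : 0 < s.re) :
    Complex.exp (4 * twoLog χ s) = localFactor 2 (χ (2 : ℕ) * ((2 : ℕ) : ℂ) ^ (-s)) := by
  have h : 4 * twoLog χ s = (2 : ℕ) * -eulerLog (χ 2) 2 s + eulerLog (χ 2 ^ 2) 2 (2 * s) := by
    unfold twoLog; push_cast; ring
  rw [h, Complex.exp_add, Complex.exp_nat_mul, Complex.exp_neg,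
    exp_eulerLog (χ.norm_le_one 2) one_lt_two hs,
    exp_eulerLog (norm_apply_pow_le_one χ 2 2) one_lt_two (by simpa using hs),
    natCast_cpow_neg_two_mul, ← mul_pow]
  simp [localFactor]

lemma correction_pow_four_hasProd {s : ℂ} (hs : 1 / 4 < s.re) :
    HasProd (fun p : Nat.Primes => localFactor p (χ (p : ℕ) * ((p : ℕ) : ℂ) ^ (-s)))
      (correction χ s ^ 4) := by
  have hs0 : 0 < s.re := by linarith
  have h1 := ((summable_oddLog χ hs).hasSum.mul_left 4).cexp
  have h2 := hasProd_ite_eq (⟨2, Nat.prime_two⟩ : Nat.Primes) (Complex.exp (4 * twoLog χ s))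
  have he : correction χ s ^ 4 = Complex.exp (4 * twoLog χ s) *
      Complex.exp (4 * ∑' p : Nat.Primes, oddLog χ p s) := by
    rw [← Complex.exp_add, ← mul_add, correction, ← Complex.exp_nat_mul]
    norm_num
  rw [he]
  refine (h2.mul h1).congr_fun fun p => ?_
  change _ = _ * Complex.exp (4 * oddLog χ p s)
  rw [exp_four_mul_oddLog χ p.prop.one_lt hs0]
  by_cases hp : p = ⟨2, Nat.prime_two⟩
  · subst hp
    simp [exp_four_mul_twoLog χ hs0]
  · have hp' : (p : ℕ) ≠ 2 := fun h => hp (Subtype.ext h)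
    simp [hp, hp', localFactor]

/-- The identity between Euler factors underlying the factorization. -/
lemma localFactor_identity {p : ℕ} (hp : p.Prime) {z : ℂ} (hz : ‖z‖ < 1) :
    (if p % 4 = 3 then (1 - z ^ 2)⁻¹ else (1 - z)⁻¹) ^ 4 * (1 - z ^ 2 * chiNeg4 p)⁻¹ =
      (1 - z)⁻¹ ^ 2 * (1 - z * chiNeg4 p)⁻¹ ^ 2 * (1 - z ^ 2)⁻¹ * localFactor p z := by
  have ne1 : ∀ w : ℂ, ‖w‖ < 1 → 1 - w ≠ 0 := fun w hw h => by
    rw [← sub_eq_zero.mp h, norm_one] at hw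
    exact lt_irrefl _ hw
  have hz2 : ‖z ^ 2‖ < 1 := by
    rw [norm_pow]; exact pow_lt_one₀ (norm_nonneg z) hz two_ne_zero
  have a1 := ne1 z hz
  have a2 : 1 + z ≠ 0 := by simpa using ne1 (-z) (by simpa using hz)
  have a3 : 1 + z ^ 2 ≠ 0 := by simpa using ne1 (-z ^ 2) (by simpa using hz2)
  have e2 : 1 - z ^ 2 = (1 - z) * (1 + z) := by ring
  have e4 : 1 - z ^ 4 = (1 - z) * (1 + z) * (1 + z ^ 2) := by ring
  rw [chiNeg4_apply, localFactor]
  rcases hp.eq_two_or_odd with rfl | hodd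
  · norm_num
    rw [e2]
    field_simp
  · have h2 : p ≠ 2 := by rintro rfl; norm_num at hodd
    have h0 : p % 2 ≠ 0 := by lia
    rcases (by lia : p % 4 = 1 ∨ p % 4 = 3) with h | h
    · simp only [h, h2, h0, if_false, if_true, mul_one]
      norm_num
      left
      field_simp
    · simp only [h, h0, if_false, if_true]
      norm_num
      rw [e2, e4]
      field_simp

lemma LSeries_STwist_factorization (hq : 0 < q) {s : ℂ} (hs : 1 < s.re) :
    LSeries (STwist χ) s ^ 4 * LVal (mulChiNeg4 (χ ^ 2)) (2 * s) =
      LVal χ s ^ 2 * LVal (mulChiNeg4 χ) s ^ 2 * LVal (χ ^ 2) (2 * s) * correction χ s ^ 4 := by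
  have hs2 : 1 < (2 * s).re := by simp; linarith
  have hl := ((LSeries_STwist_hasProd χ hs).pow 4).mul
    (LVal_hasProd (by lia) (mulChiNeg4 (χ ^ 2)) hs2)
  have hr := ((((LVal_hasProd hq χ hs).pow 2).mul
    ((LVal_hasProd (by lia) (mulChiNeg4 χ) hs).pow 2)).mul
    (LVal_hasProd hq (χ ^ 2) hs2)).mul (correction_pow_four_hasProd χ (s := s) (by linarith))
  refine hl.unique (hr.congr_fun fun p => ?_)
  have h := localFactor_identity p.prop
    (norm_mul_natCast_cpow_neg_lt_one (χ.norm_le_one (p : ℕ)) p.prop.one_lt (one_pos.trans hs))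
  simp only [mulChiNeg4_apply, MulChar.pow_apply' _ two_ne_zero, natCast_cpow_neg_two_mul]
  convert h using 3 <;> ring

/-! ### The value at `1/2` for real characters -/

variable {χ}

lemma re_sq_of_real (hχ : ∀ n : ZMod q, (χ n).im = 0) {p : ℕ} (hp : p.Prime) :
    (χ p).re ^ 2 = if p ∣ q then 0 else 1 := by
  split_ifs with h
  · have hu : ¬ IsUnit (p : ZMod q) := by
      rwa [ZMod.isUnit_iff_coprime, hp.coprime_iff_not_dvd, not_not]
    simp [MulChar.map_nonunit χ hu]
  · have hu : IsUnit (p : ZMod q) := by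
      rwa [ZMod.isUnit_iff_coprime, hp.coprime_iff_not_dvd]
    have h1 : ‖χ p‖ = 1 := by
      obtain ⟨u, hu⟩ := hu
      rw [← hu]
      exact χ.unit_norm_eq_one u
    have h2 := Complex.sq_norm (χ p)
    rw [h1, normSq_apply, hχ] at h2
    linarith

lemma apply_eq_ofReal_re (hχ : ∀ n : ZMod q, (χ n).im = 0) (n : ZMod q) :
    χ n = ((χ n).re : ℂ) := Complex.ext (by simp) (by simp [hχ])

lemma abs_re_apply_le_one (n : ZMod q) : |(χ n).re| ≤ 1 :=
  (abs_re_le_norm _).trans (χ.norm_le_one n)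

lemma exp_twoLog_one_half (hχ : ∀ n : ZMod q, (χ n).im = 0) :
    Complex.exp (twoLog χ (1 / 2)) =
      (((1 - (χ 2).re / Real.sqrt 2) ^ (-(1 / 2) : ℝ) *
        (1 - (if 2 ∣ q then 0 else 1) / 2 : ℝ) ^ ((1 : ℝ) / 4) : ℝ) : ℂ) := by
  have hsq : (χ 2).re ^ 2 = if 2 ∣ q then 0 else 1 := by
    exact_mod_cast re_sq_of_real hχ Nat.prime_two
  obtain ⟨pos1, h1⟩ := eulerLog_ofReal (abs_re_apply_le_one (χ := χ) 2) one_lt_two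
    (x := 1 / 2) (by norm_num)
  obtain ⟨pos2, h2⟩ := eulerLog_ofReal (c := (χ 2).re ^ 2)
    (by rw [abs_pow]; exact pow_le_one₀ (abs_nonneg _) (abs_re_apply_le_one (χ := χ) 2))
    one_lt_two (x := 1) one_pos
  have e1 : (χ 2).re * ((2 : ℕ) : ℝ) ^ (-(1 / 2) : ℝ) = (χ 2).re / Real.sqrt 2 := by
    rw [Real.rpow_neg (by positivity), Real.sqrt_eq_rpow, div_eq_mul_inv (χ 2).re, Nat.cast_ofNat]
  have e2 : (χ 2).re ^ 2 * ((2 : ℕ) : ℝ) ^ (-1 : ℝ) = (if 2 ∣ q then 0 else 1) / 2 := by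
    rw [hsq, Real.rpow_neg_one, div_eq_mul_inv, Nat.cast_ofNat]
  rw [e1] at pos1 h1
  rw [e2] at pos2 h2
  have hx := apply_eq_ofReal_re hχ 2
  generalize (χ 2).re = x at *
  rw [Real.rpow_def_of_pos pos1, Real.rpow_def_of_pos pos2, ← Real.exp_add, ofReal_exp, twoLog,
    hx, ← ofReal_pow, show (1 / 2 : ℂ) = ((1 / 2 : ℝ) : ℂ) by push_cast; rfl,
    show (2 : ℂ) * ((1 / 2 : ℝ) : ℂ) = ((1 : ℝ) : ℂ) by push_cast; norm_num, h1, h2]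
  push_cast
  ring_nf

lemma oddLog_one_half (hχ : ∀ n : ZMod q, (χ n).im = 0) {p : ℕ} (hp : p.Prime) :
    ∃ r : ℝ, oddLog χ p (1 / 2) = r ∧ Real.exp r =
      if p % 4 = 3 ∧ ¬ p ∣ q then (1 - 1 / (p : ℝ) ^ (2 : ℕ)) ^ (-(1 / 4) : ℝ) else 1 := by
  have hsq := re_sq_of_real hχ hp
  have h4 : χ p ^ 4 = (((χ p).re ^ 2 : ℝ) : ℂ) ^ 2 := by
    rw [apply_eq_ofReal_re hχ p]; push_cast; simp; ring
  rw [hsq] at h4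
  unfold oddLog
  by_cases h3 : p % 4 = 3
  · by_cases hd : p ∣ q
    · refine ⟨0, ?_, ?_⟩ <;> simp [h4, hd, h3, eulerLog]
    · obtain ⟨pos, h⟩ := eulerLog_ofReal (c := 1) (by simp) hp.one_lt (x := 2) two_pos
      have e : (1 : ℝ) * (p : ℝ) ^ (-2 : ℝ) = 1 / (p : ℝ) ^ (2 : ℕ) := by
        rw [Real.rpow_neg (by positivity), one_mul, one_div, Real.rpow_ofNat]
      rw [e] at pos h
      refine ⟨Real.log (1 - 1 / (p : ℝ) ^ 2) * (-(1 / 4)), ?_, ?_⟩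
      · rw [if_pos h3, h4, if_neg hd, ofReal_one, one_pow, ofReal_mul, ← h]
        norm_num
        ring
      · rw [if_pos ⟨h3, hd⟩, Real.rpow_def_of_pos pos]
  · exact ⟨0, by simp [h3], by simp [h3]⟩

lemma correction_one_half (hχ : ∀ n : ZMod q, (χ n).im = 0) :
    correction χ (1 / 2) = (((1 - (χ 2).re / Real.sqrt 2) ^ (-(1 / 2) : ℝ) *
      (1 - (if 2 ∣ q then 0 else 1) / 2 : ℝ) ^ ((1 : ℝ) / 4) *
      ∏' p : Nat.Primes, if (p : ℕ) % 4 = 3 ∧ ¬((p : ℕ) ∣ q)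
        then (1 - 1 / (p : ℝ) ^ (2 : ℕ)) ^ (-(1 / 4) : ℝ) else 1 : ℝ) : ℂ) := by
  choose r hr hexp using fun p : Nat.Primes => oddLog_one_half hχ p.prop
  have hsum := (summable_oddLog χ (s := 1 / 2) (by norm_num)).hasSum
  simp only [hr] at hsum
  have hsum' : HasSum r (∑' p, r p) := by
    rwa [← ofReal_tsum, hasSum_ofReal] at hsum
  have hprod := hsum'.rexp.tprod_eq
  simp only [Function.comp_apply, hexp] at hprod
  rw [correction, Complex.exp_add, exp_twoLog_one_half hχ, hprod, tsum_congr hr,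
    ← ofReal_tsum, ← ofReal_exp, ← ofReal_mul]

end

/-- **Lemma 2.1:** factorization of the generating function of twisted sums of two squares
(stated with fourth powers to fix the branches, and with the normalization `G → 1` as
`Re s → ∞`, which pins down the branch of the roots). -/
theorem generating_function_factorization
    (q : ℕ) (hq : 0 < q) (χ : DirichletCharacter ℂ q) :
    ∃ G : ℂ → ℂ,
      DifferentiableOn ℂ G {s : ℂ | 1 / 4 < s.re} ∧
      (∀ s : ℂ, 1 / 4 < s.re → G s ≠ 0) ∧
      (∀ ε : ℝ, 0 < ε → ∃ M : ℝ, ∀ s : ℂ, 1 / 4 + ε ≤ s.re → ‖G s‖ ≤ M) ∧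
      Tendsto (fun σ : ℝ => G (σ : ℂ)) atTop (nhds 1) ∧
      (∀ s : ℂ, 1 < s.re →
        LSeries (STwist χ) s ^ 4 * LVal (mulChiNeg4 (χ ^ 2)) (2 * s) =
          LVal χ s ^ 2 * LVal (mulChiNeg4 χ) s ^ 2 * LVal (χ ^ 2) (2 * s) * G s ^ 4) ∧
      ((∀ n : ZMod q, (χ n).im = 0) →
        G (1 / 2) = ((1 - (χ (2 : ZMod q)).re / Real.sqrt 2) ^ (-(1 / 2) : ℝ) *
          ((1 - (if 2 ∣ q then 0 else 1) / 2 : ℝ) ^ ((1 : ℝ) / 4)) *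
          ∏' p : Nat.Primes, if (p : ℕ) % 4 = 3 ∧ ¬((p : ℕ) ∣ q)
            then (1 - 1 / (p : ℝ) ^ (2 : ℕ)) ^ (-(1 / 4) : ℝ) else 1 : ℝ)) := by
  exact ⟨correction χ, differentiableOn_correction χ, fun s _ => Complex.exp_ne_zero _,
    fun ε hε => norm_correction_le χ hε, tendsto_correction χ,
    fun s hs => LSeries_STwist_factorization χ hq hs, fun hχ => correction_one_half hχ⟩

end
end

section
/- Let χ be a Dirichlet character satisfying GRH, fix c ∈ (0,1/8), and let ε > 0. Then there is a constant C = C(χ, c, ε) such that for every non-trivial zero ρ = 1/2 + iγ of L(s,χ) and every sufficiently small radius r, max_{s ∈ H_ρ} |L(s,χ)/(s − ρ)| ≤ C(|γ| + 1)^{c+ε}. -/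
open Complex Filter
open scoped Classical

noncomputable section

/-- Partial sums of a mean-zero function on `ZMod N` are `N`-periodic. -/
lemma periodic_sum_range_zmod {N : ℕ} [NeZero N] (Ψ : ZMod N → ℂ) (h : ∑ j, Ψ j = 0) :
    Function.Periodic (fun n : ℕ => ∑ k ∈ Finset.range n, Ψ (k : ZMod N)) N := by
  intro n
  have hbase : ∑ k ∈ Finset.range N, Ψ (k : ZMod N) = 0 := by
    obtain ⟨M, rfl⟩ : ∃ M, N = M + 1 := ⟨N - 1, (Nat.succ_pred_eq_of_pos (NeZero.pos N)).symm⟩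
    rw [← Fin.sum_univ_eq_sum_range (fun k => Ψ (k : ZMod (M + 1)))]
    rw [← h]
    refine Finset.sum_congr rfl fun j _ => ?_
    congr 1
    exact Fin.cast_val_eq_self j
  induction n with
  | zero => simpa using hbase
  | succ n ih =>
    have : n + 1 + N = (n + N) + 1 := by ring
    simp only [this, Finset.sum_range_succ] at ih ⊢
    rw [ih]
    simp

lemma exists_norm_sum_zmod_sub_le {N : ℕ} [NeZero N] (Φ : ZMod N → ℂ) :
    ∃ K : ℝ, ∀ n : ℕ,
      ‖∑ k ∈ Finset.Icc 1 n, Φ (k : ZMod N) - (∑ j, Φ j) / N * n‖ ≤ K := by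
  set κ : ℂ := (∑ j, Φ j) / N with hκ
  have hN : (N : ℂ) ≠ 0 := Nat.cast_ne_zero.mpr (NeZero.ne N)
  have hsum : ∑ j : ZMod N, (Φ j - κ) = 0 := by
    rw [Finset.sum_sub_distrib, Finset.sum_const, Finset.card_univ, ZMod.card, nsmul_eq_mul, hκ]
    field_simp
    ring
  have hper := periodic_sum_range_zmod (fun j => Φ j - κ) hsum
  set h : ℕ → ℂ := fun n : ℕ => ∑ k ∈ Finset.range n, (Φ (k : ZMod N) - κ) with hh
  refine ⟨∑ m ∈ Finset.range N, ‖h m‖ + ‖κ - Φ 0‖, fun n => ?_⟩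
  have hb : ‖h (n + 1)‖ ≤ ∑ m ∈ Finset.range N, ‖h m‖ := by
    rw [← hper.map_mod_nat (n + 1)]
    exact Finset.single_le_sum (f := fun m => ‖h m‖) (fun _ _ => norm_nonneg _)
      (Finset.mem_range.mpr (Nat.mod_lt _ (NeZero.pos N)))
  have heq : ∑ k ∈ Finset.Icc 1 n, Φ (k : ZMod N) - κ * n = h (n + 1) + (κ - Φ 0) := by
    have h1 : ∑ k ∈ Finset.range (n + 1), Φ (k : ZMod N)
        = ∑ k ∈ Finset.Icc 1 n, Φ (k : ZMod N) + Φ 0 := by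
      rw [Finset.sum_range_succ', Nat.cast_zero]
      congr 1
      rw [Finset.range_eq_Ico, Finset.sum_Ico_add' (fun k : ℕ => Φ (k : ZMod N)) 0 n 1]
      rfl
    simp only [hh, Finset.sum_sub_distrib, h1, Finset.sum_const, Finset.card_range, nsmul_eq_mul]
    push_cast
    ring
  rw [heq]
  exact (norm_add_le _ _).trans (by gcongr)

/-- The error term in the count of a periodic function, cut off to `(1, ∞)`. -/
def zmodSumError {N : ℕ} [NeZero N] (Φ : ZMod N → ℂ) : ℝ → ℂ :=
  (Set.Ioi (1 : ℝ)).indicator fun t =>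
    ∑ k ∈ Finset.Icc 1 ⌊t⌋₊, Φ (k : ZMod N) - (∑ j, Φ j) / N * t

lemma measurable_zmodSumError {N : ℕ} [NeZero N] (Φ : ZMod N → ℂ) :
    Measurable (zmodSumError Φ) := by
  refine Measurable.indicator (Measurable.sub ?_ ?_) measurableSet_Ioi
  · exact (measurable_from_nat (f := fun n => ∑ k ∈ Finset.Icc 1 n, Φ (k : ZMod N))).comp
      Nat.measurable_floor
  · exact measurable_const.mul Complex.measurable_ofReal

lemma exists_norm_zmodSumError_le {N : ℕ} [NeZero N] (Φ : ZMod N → ℂ) :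
    ∃ K : ℝ, 0 ≤ K ∧ ∀ t, ‖zmodSumError Φ t‖ ≤ K := by
  obtain ⟨K, hK⟩ := exists_norm_sum_zmod_sub_le Φ
  have hK0 : 0 ≤ K := (norm_nonneg _).trans (hK 0)
  refine ⟨K + ‖(∑ j, Φ j) / (N : ℂ)‖, by positivity, fun t => ?_⟩
  unfold zmodSumError
  by_cases ht : t ∈ Set.Ioi (1 : ℝ)
  · rw [Set.indicator_of_mem ht]
    have ht0 : (0 : ℝ) ≤ t := zero_le_one.trans (le_of_lt ht)
    have hfl : ‖((⌊t⌋₊ : ℂ) - t)‖ ≤ 1 := by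
      have h1 := Nat.floor_le ht0
      have h2 := Nat.lt_floor_add_one t
      rw [← Complex.ofReal_natCast, ← Complex.ofReal_sub, Complex.norm_real, Real.norm_eq_abs,
        abs_le]
      constructor <;> linarith
    calc _ = ‖(∑ k ∈ Finset.Icc 1 ⌊t⌋₊, Φ (k : ZMod N) - (∑ j, Φ j) / N * (⌊t⌋₊ : ℂ))
          + (∑ j, Φ j) / N * ((⌊t⌋₊ : ℂ) - t)‖ := by ring_nf
      _ ≤ K + ‖(∑ j, Φ j) / (N : ℂ)‖ * 1 := by
        refine (norm_add_le _ _).trans (add_le_add (hK _) ?_)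
        rw [norm_mul]
        gcongr
      _ = _ := by ring
  · rw [Set.indicator_of_notMem ht, norm_zero]
    positivity

lemma mellin_zmodSumError_eq {N : ℕ} [NeZero N] (Φ : ZMod N → ℂ) (s : ℂ) :
    mellin (zmodSumError Φ) (-s) = ∫ t in Set.Ioi (1 : ℝ), (t : ℂ) ^ (-s - 1) *
      (∑ k ∈ Finset.Icc 1 ⌊t⌋₊, Φ (k : ZMod N) - (∑ j, Φ j) / N * t) := by
  rw [mellin]
  have : (fun t : ℝ => (t : ℂ) ^ (-s - 1) • zmodSumError Φ t) =
      (Set.Ioi (1 : ℝ)).indicator (fun t => (t : ℂ) ^ (-s - 1) *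
        (∑ k ∈ Finset.Icc 1 ⌊t⌋₊, Φ (k : ZMod N) - (∑ j, Φ j) / N * t)) := by
    ext t
    unfold zmodSumError
    by_cases ht : t ∈ Set.Ioi (1 : ℝ)
    · simp [Set.indicator_of_mem ht]
    · simp [Set.indicator_of_notMem ht]
  rw [this, MeasureTheory.setIntegral_indicator measurableSet_Ioi,
    Set.inter_eq_right.mpr (Set.Ioi_subset_Ioi zero_le_one)]

lemma differentiableAt_mellin_zmodSumError {N : ℕ} [NeZero N] (Φ : ZMod N → ℂ) {s : ℂ}
    (hs : s.re < 0) : DifferentiableAt ℂ (mellin (zmodSumError Φ)) s := by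
  obtain ⟨K, hK0, hK⟩ := exists_norm_zmodSumError_le Φ
  refine mellin_differentiableAt_of_isBigO_rpow (a := 0) (b := s.re - 1) ?_ ?_ hs ?_ (by linarith)
  · refine MeasureTheory.LocallyIntegrable.locallyIntegrableOn ?_ _
    refine (MeasureTheory.locallyIntegrable_const K).mono
      (measurable_zmodSumError Φ).aestronglyMeasurable (Eventually.of_forall fun t => ?_)
    rw [Real.norm_of_nonneg hK0]
    exact hK t
  · refine Asymptotics.IsBigO.of_bound K (Eventually.of_forall fun t => ?_)
    simpa using hK t
  · refine Asymptotics.IsBigO.of_bound 0 ?_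
    filter_upwards [nhdsWithin_le_nhds (Iio_mem_nhds (zero_lt_one' ℝ))] with t ht
    have : t ∉ Set.Ioi (1 : ℝ) := fun h => lt_asymm (Set.mem_Ioi.mp h) (Set.mem_Iio.mp ht)
    simp [zmodSumError, Set.indicator_of_notMem this]

lemma norm_mellin_zmodSumError_le {N : ℕ} [NeZero N] (Φ : ZMod N → ℂ) :
    ∃ K : ℝ, 0 ≤ K ∧ ∀ s : ℂ, 0 < s.re → ‖mellin (zmodSumError Φ) (-s)‖ ≤ K / s.re := by
  obtain ⟨K, hK0, hK⟩ := exists_norm_zmodSumError_le Φ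
  refine ⟨K, hK0, fun s hs => ?_⟩
  rw [mellin_zmodSumError_eq]
  have hdom : MeasureTheory.IntegrableOn (fun t : ℝ => t ^ (-s.re - 1) * K) (Set.Ioi 1) :=
    (integrableOn_Ioi_rpow_of_lt (by linarith) zero_lt_one).mul_const K
  refine (MeasureTheory.norm_integral_le_of_norm_le hdom ?_).trans (le_of_eq ?_)
  · refine (MeasureTheory.ae_restrict_iff' measurableSet_Ioi).mpr (Eventually.of_forall ?_)
    intro t ht
    have ht0 : (0 : ℝ) < t := zero_lt_one.trans ht
    have := hK t
    rw [zmodSumError, Set.indicator_of_mem ht] at this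
    rw [norm_mul, Complex.norm_cpow_eq_rpow_re_of_pos ht0]
    simp only [sub_re, neg_re, one_re]
    gcongr
  · rw [MeasureTheory.integral_mul_const, integral_Ioi_rpow_of_lt (by linarith) zero_lt_one]
    have h1 : -s.re - 1 + 1 = -s.re := by ring
    rw [h1, Real.one_rpow]
    field_simp

lemma ZMod.LFunction_eq_mellin_of_one_lt_re {N : ℕ} [NeZero N] (Φ : ZMod N → ℂ) {s : ℂ}
    (hs : 1 < s.re) :
    ZMod.LFunction Φ s
      = s * mellin (zmodSumError Φ) (-s) + (∑ j, Φ j) / N * (s / (s - 1)) := by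
  obtain ⟨K, hK0, hK⟩ := exists_norm_zmodSumError_le Φ
  have hs0 : s ≠ 0 := by rintro rfl; simp at hs; linarith
  have hs1 : s - 1 ≠ 0 := by
    intro h
    rw [sub_eq_zero.mp h] at hs
    simp at hs
  have hO : (fun n : ℕ => ∑ k ∈ Finset.Icc 1 n, ‖Φ (k : ZMod N)‖) =O[atTop]
      fun n => (n : ℝ) ^ (1 : ℝ) := by
    refine Asymptotics.IsBigO.of_bound (∑ j, ‖Φ j‖) (Eventually.of_forall fun n => ?_)
    rw [Real.norm_of_nonneg (Finset.sum_nonneg fun _ _ => norm_nonneg _), Real.rpow_one,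
      Real.norm_of_nonneg (Nat.cast_nonneg n)]
    calc _ ≤ ∑ k ∈ Finset.Icc 1 n, ∑ j, ‖Φ j‖ := Finset.sum_le_sum fun k _ =>
          Finset.single_le_sum (f := fun j => ‖Φ j‖) (fun _ _ => norm_nonneg _)
            (Finset.mem_univ (k : ZMod N))
      _ = _ := by simp [mul_comm]
  rw [ZMod.LFunction_eq_LSeries Φ hs, LSeries_eq_mul_integral' _ zero_le_one hs hO,
    mellin_zmodSumError_eq]
  have hi1 : MeasureTheory.IntegrableOn (fun t : ℝ => (t : ℂ) ^ (-s - 1) *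
      (∑ k ∈ Finset.Icc 1 ⌊t⌋₊, Φ (k : ZMod N) - (∑ j, Φ j) / N * t)) (Set.Ioi 1) := by
    have hb : MeasureTheory.IntegrableOn (fun t : ℝ => (t : ℂ) ^ (-s - 1) * zmodSumError Φ t)
        (Set.Ioi 1) := by
      refine MeasureTheory.Integrable.mul_bdd
        (integrableOn_Ioi_cpow_of_lt (by simp; linarith) zero_lt_one)
        (measurable_zmodSumError Φ).aestronglyMeasurable (c := K) (Eventually.of_forall hK)
    refine hb.congr_fun (fun t ht => ?_) measurableSet_Ioi
    simp only [zmodSumError, Set.indicator_of_mem ht]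
  have hi2 : MeasureTheory.IntegrableOn (fun t : ℝ => (∑ j, Φ j) / N * (t : ℂ) ^ (-s))
      (Set.Ioi 1) :=
    (integrableOn_Ioi_cpow_of_lt (by simp; linarith) zero_lt_one).const_mul _
  have hsplit : ∫ t in Set.Ioi (1 : ℝ), (∑ k ∈ Finset.Icc 1 ⌊t⌋₊, Φ (k : ZMod N)) *
      (t : ℂ) ^ (-(s + 1)) = (∫ t in Set.Ioi (1 : ℝ), (t : ℂ) ^ (-s - 1) *
      (∑ k ∈ Finset.Icc 1 ⌊t⌋₊, Φ (k : ZMod N) - (∑ j, Φ j) / N * t)) +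
      ∫ t in Set.Ioi (1 : ℝ), (∑ j, Φ j) / N * (t : ℂ) ^ (-s) := by
    rw [← MeasureTheory.integral_add hi1 hi2]
    refine MeasureTheory.setIntegral_congr_fun measurableSet_Ioi fun t ht => ?_
    have ht0 : (t : ℂ) ≠ 0 := by
      have : (0 : ℝ) < t := zero_lt_one.trans ht
      exact_mod_cast this.ne'
    have e1 : (t : ℂ) ^ (-s) = (t : ℂ) ^ (-s - 1) * t := by
      rw [cpow_sub _ _ ht0, cpow_one]
      field_simp
    simp only [e1, show -(s + 1) = -s - 1 by ring]
    ring
  rw [hsplit, MeasureTheory.integral_const_mul,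
    integral_Ioi_cpow_of_lt (by simp; linarith) zero_lt_one]
  have hs2 : -s + 1 ≠ 0 := fun h => hs1 (by linear_combination -h)
  simp only [ofReal_one, one_cpow]
  field_simp
  ring

lemma ZMod.LFunction_eq_mellin {N : ℕ} [NeZero N] (Φ : ZMod N → ℂ) {s : ℂ}
    (hs : 0 < s.re) (hs' : s.im ≠ 0) :
    ZMod.LFunction Φ s
      = s * mellin (zmodSumError Φ) (-s) + (∑ j, Φ j) / N * (s / (s - 1)) := by
  set U : Set ℂ := {z | 0 < z.re} ∩ {z | 0 < s.im * z.im} with hU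
  have hUo : IsOpen U := (isOpen_lt continuous_const continuous_re).inter
    (isOpen_lt continuous_const (by fun_prop))
  have hUc : Convex ℝ U := by
    refine (convex_halfSpace_re_gt 0).inter ?_
    exact convex_halfSpace_gt (f := fun z : ℂ => s.im * z.im)
      ⟨fun x y => by simp; ring, fun c x => by simp; ring⟩ 0
  have hne : ∀ z ∈ U, z ≠ 1 := by
    rintro z ⟨_, hz⟩ rfl
    simp at hz
  have hsU : s ∈ U := ⟨hs, mul_self_pos.mpr hs'⟩
  have hzU : (2 + s.im * I : ℂ) ∈ U := by
    refine ⟨by simp, ?_⟩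
    simpa using mul_self_pos.mpr hs'
  refine AnalyticOnNhd.eqOn_of_preconnected_of_eventuallyEq (𝕜 := ℂ) (U := U)
    (f := ZMod.LFunction Φ)
    (g := fun s => s * mellin (zmodSumError Φ) (-s) + (∑ j, Φ j) / N * (s / (s - 1)))
    ?_ ?_ hUc.isPreconnected hzU ?_ hsU
  · refine DifferentiableOn.analyticOnNhd (fun z hz => ?_) hUo
    exact (ZMod.differentiableAt_LFunction Φ z (Or.inl (hne z hz))).differentiableWithinAt
  · refine DifferentiableOn.analyticOnNhd (fun z hz => ?_) hUo
    refine DifferentiableAt.differentiableWithinAt ?_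
    have h1 : DifferentiableAt ℂ (fun s => mellin (zmodSumError Φ) (-s)) z :=
      DifferentiableAt.comp (g := mellin (zmodSumError Φ)) z
        (differentiableAt_mellin_zmodSumError Φ (by simpa using hz.1)) differentiableAt_id.neg
    refine (differentiableAt_id.mul h1).add ((differentiableAt_id.div ?_ ?_).const_mul _)
    · fun_prop
    · simpa [sub_eq_zero] using hne z hz
  · have : {z : ℂ | 1 < z.re} ∈ nhds (2 + s.im * I : ℂ) :=
      (isOpen_lt continuous_const continuous_re).mem_nhds (by simp)
    filter_upwards [this] with z hz
    exact ZMod.LFunction_eq_mellin_of_one_lt_re Φ hz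

/-- `L`-functions of periodic functions grow at most linearly in `1/2 ≤ Re s`. -/
lemma ZMod.exists_norm_LFunction_le {N : ℕ} [NeZero N] (Φ : ZMod N → ℂ) :
    ∃ C : ℝ, 1 ≤ C ∧ ∀ s : ℂ, 1 / 2 ≤ s.re → 1 ≤ |s.im| → ‖ZMod.LFunction Φ s‖ ≤ C * ‖s‖ := by
  obtain ⟨K, hK0, hK⟩ := norm_mellin_zmodSumError_le Φ
  refine ⟨2 * K + ‖(∑ j, Φ j) / (N : ℂ)‖ + 1, ?_, fun s hs hs' => ?_⟩
  · have := norm_nonneg ((∑ j, Φ j) / (N : ℂ))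
    linarith
  have him : s.im ≠ 0 := by
    intro h
    rw [h] at hs'
    simp at hs'
    linarith
  rw [ZMod.LFunction_eq_mellin Φ (by linarith) him]
  have h1 : ‖mellin (zmodSumError Φ) (-s)‖ ≤ 2 * K := by
    refine (hK s (by linarith)).trans ?_
    rw [div_le_iff₀ (by linarith)]
    nlinarith
  have h2 : ‖s / (s - 1)‖ ≤ ‖s‖ := by
    rw [norm_div]
    refine div_le_self (norm_nonneg _) (hs'.trans ?_)
    simpa using Complex.abs_im_le_norm (s - 1)
  calc _ ≤ ‖s‖ * (2 * K) + ‖(∑ j, Φ j) / (N : ℂ)‖ * ‖s‖ := by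
        refine (norm_add_le _ _).trans ?_
        rw [norm_mul, norm_mul]
        gcongr
    _ ≤ _ := by nlinarith [norm_nonneg s]

/-- A nonvanishing holomorphic function on a disc has a holomorphic logarithm. -/
lemma exists_differentiableOn_exp_eq {h : ℂ → ℂ} {R : ℝ} (hR : 0 < R)
    (hd : DifferentiableOn ℂ h (Metric.ball 0 R)) (hne : ∀ z ∈ Metric.ball (0 : ℂ) R, h z ≠ 0)
    (h0 : h 0 = 1) :
    ∃ g : ℂ → ℂ, DifferentiableOn ℂ g (Metric.ball 0 R) ∧ g 0 = 0 ∧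
      ∀ z ∈ Metric.ball (0 : ℂ) R, exp (g z) = h z := by
  have hd' : DifferentiableOn ℂ (fun z => deriv h z / h z) (Metric.ball 0 R) :=
    (hd.deriv Metric.isOpen_ball).div hd hne
  obtain ⟨g, hg0, hg⟩ := hd'.isExactOn_ball.with_val_at 0 0
  refine ⟨g, fun z hz => (hg z hz).differentiableAt.differentiableWithinAt, hg0, fun z hz => ?_⟩
  have hcon : ∀ w ∈ Metric.ball (0 : ℂ) R,
      HasDerivAt (fun w => exp (-g w) * h w) 0 w := by
    intro w hw
    have h1 := (hd.differentiableAt (Metric.isOpen_ball.mem_nhds hw)).hasDerivAt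
    refine ((hg w hw).neg.cexp.mul h1).congr_deriv ?_
    have := hne w hw
    field_simp
    ring
  have hconst := (convex_ball (0 : ℂ) R).is_const_of_fderivWithin_eq_zero (𝕜 := ℂ)
    (f := fun w => exp (-g w) * h w)
    (fun w hw => (hcon w hw).differentiableAt.differentiableWithinAt)
    (fun w hw => by
      rw [fderivWithin_of_isOpen Metric.isOpen_ball hw]
      ext
      simp [(hcon w hw).deriv]) hz (Metric.mem_ball_self hR)
  simp only [hg0, h0, neg_zero, exp_zero, mul_one, exp_neg] at hconst
  field_simp at hconst
  exact hconst.symm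

/-- Hadamard's three circles theorem. -/
lemma norm_le_of_three_circles {g : ℂ → ℂ} {r R₁ R a b : ℝ} (hr : 0 < r) (hrR : r < R₁)
    (hR : R₁ < R) (hd : DifferentiableOn ℂ g (Metric.ball 0 R))
    (ha : ∀ z : ℂ, ‖z‖ = r → ‖g z‖ ≤ a) (hb : ∀ z : ℂ, ‖z‖ ≤ R₁ → ‖g z‖ ≤ b) {z : ℂ}
    (hz1 : r ≤ ‖z‖) (hz2 : ‖z‖ ≤ R₁) :
    ‖g z‖ ≤ a ^ (1 - (Real.log ‖z‖ - Real.log r) / (Real.log R₁ - Real.log r)) *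
      b ^ ((Real.log ‖z‖ - Real.log r) / (Real.log R₁ - Real.log r)) := by
  have hR₁ : 0 < R₁ := hr.trans hrR
  have hz0 : 0 < ‖z‖ := hr.trans_le hz1
  have hz : z ≠ 0 := norm_pos_iff.mp hz0
  have hlog : Real.log r < Real.log R₁ := Real.log_lt_log hr hrR
  have hnorm : ∀ w : ℂ, w.re ≤ Real.log R₁ → ‖exp w‖ ≤ R₁ := fun w hw => by
    rw [Complex.norm_exp]
    exact (Real.le_log_iff_exp_le hR₁).mp hw
  have hnorm' : ∀ w : ℂ, w.re ≤ Real.log R₁ → exp w ∈ Metric.ball (0 : ℂ) R := fun w hw => by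
    rw [mem_ball_zero_iff]
    exact (hnorm w hw).trans_lt hR
  have hdiff : ∀ w : ℂ, w.re ≤ Real.log R₁ → DifferentiableAt ℂ (fun w => g (exp w)) w :=
    fun w hw => DifferentiableAt.comp (g := g) w
      (hd.differentiableAt (Metric.isOpen_ball.mem_nhds (hnorm' w hw))) differentiable_exp.differentiableAt
  have key := Complex.HadamardThreeLines.norm_le_interp_of_mem_verticalClosedStrip'
    (f := fun w => g (exp w)) (z := log z) (a := a) (b := b) hlog ?_ ?_ ?_ ?_ ?_
  · simpa only [exp_log hz, log_re] using key
  · rw [Complex.HadamardThreeLines.verticalClosedStrip, Set.mem_preimage, log_re]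
    exact ⟨Real.log_le_log hr hz1, Real.log_le_log hz0 hz2⟩
  · refine DifferentiableOn.diffContOnCl fun w hw => (hdiff w ?_).differentiableWithinAt
    have hsub : closure (Complex.HadamardThreeLines.verticalStrip (Real.log r) (Real.log R₁))
        ⊆ Complex.HadamardThreeLines.verticalClosedStrip (Real.log r) (Real.log R₁) :=
      closure_minimal (Set.preimage_mono Set.Ioo_subset_Icc_self) (isClosed_Icc.preimage continuous_re)
    exact (hsub hw).2
  · refine ⟨b, ?_⟩
    rintro _ ⟨w, hw, rfl⟩
    exact hb _ (hnorm w hw.2)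
  · intro w hw
    refine ha _ ?_
    rw [Complex.norm_exp, Set.mem_singleton_iff.mp hw, Real.exp_log hr]
  · intro w hw
    exact hb _ (hnorm w (le_of_eq hw))

lemma exists_mul_rpow_le_add_mul {A θ η : ℝ} (hA : 0 ≤ A) (hθ0 : 0 ≤ θ) (hθ1 : θ < 1)
    (hη : 0 < η) : ∃ K : ℝ, ∀ M : ℝ, 0 ≤ M → A * M ^ θ ≤ K + η * M := by
  have h1 : 0 < 1 - θ := by linarith
  set X : ℝ := (A * η ^ (-θ)) ^ (1 - θ)⁻¹ with hX
  have hAη : 0 ≤ A * η ^ (-θ) := by positivity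
  have hX0 : 0 ≤ X := Real.rpow_nonneg hAη _
  refine ⟨X, fun M hM => ?_⟩
  have key := Real.geom_mean_le_arith_mean2_weighted h1.le hθ0 hX0 (mul_nonneg hη.le hM)
    (by ring)
  have e1 : X ^ (1 - θ) = A * η ^ (-θ) := by
    rw [hX, ← Real.rpow_mul hAη, inv_mul_cancel₀ h1.ne', Real.rpow_one]
  rw [e1, Real.mul_rpow hη.le hM] at key
  have e2 : A * η ^ (-θ) * (η ^ θ * M ^ θ) = A * M ^ θ := by
    rw [Real.rpow_neg hη.le]
    have : η ^ θ ≠ 0 := (Real.rpow_pos_of_pos hη θ).ne'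
    field_simp
  rw [e2] at key
  have hM' := mul_nonneg hη.le hM
  nlinarith

/-- A nonvanishing holomorphic function on a disc, bounded on a smaller concentric disc, has
a logarithm which on intermediate discs is small compared with its maximum. -/
lemma exists_norm_le_exp_of_ne_zero {r ρ R B η : ℝ} (hr : 0 < r) (hrρ : r ≤ ρ) (hρR : ρ < R)
    (hB : 0 < B) (hη : 0 < η) :
    ∃ K : ℝ, ∀ (M : ℝ) (h : ℂ → ℂ), 0 < M → DifferentiableOn ℂ h (Metric.ball 0 R) →
      (∀ z ∈ Metric.ball (0 : ℂ) R, h z ≠ 0) → h 0 = 1 →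
      (∀ z ∈ Metric.ball (0 : ℂ) r, ‖h z‖ ≤ Real.exp B) →
      (∀ z ∈ Metric.ball (0 : ℂ) R, ‖h z‖ ≤ Real.exp M) →
      ∀ z : ℂ, ‖z‖ ≤ ρ → ‖h z‖ ≤ Real.exp (K + η * M) := by
  obtain ⟨R₁, hρR₁, hR₁R⟩ := exists_between hρR
  have hρ0 : 0 < ρ := hr.trans_le hrρ
  have hR0 : 0 < R := hρ0.trans hρR
  have hR₁0 : 0 < R₁ := hρ0.trans hρR₁
  set C : ℝ := 2 * R₁ / (R - R₁) with hC
  have hC0 : 0 < C := div_pos (by linarith) (by linarith)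
  set θ : ℝ := (Real.log ρ - Real.log (r / 2)) / (Real.log R₁ - Real.log (r / 2)) with hθ
  have hl1 : Real.log (r / 2) < Real.log ρ := Real.log_lt_log (by linarith) (by linarith)
  have hl2 : Real.log ρ < Real.log R₁ := Real.log_lt_log hρ0 hρR₁
  have hθ0 : 0 ≤ θ := div_nonneg (by linarith) (by linarith)
  have hθ1 : θ < 1 := (div_lt_one (by linarith)).mpr (by linarith)
  obtain ⟨K, hK⟩ := exists_mul_rpow_le_add_mul (A := (2 * B) ^ (1 - θ) * C ^ θ) (by positivity)
    hθ0 hθ1 hη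
  refine ⟨K, fun M h hM hd hne h0 hsmall hbig z hz => ?_⟩
  obtain ⟨g, hgd, hg0, hg⟩ := exists_differentiableOn_exp_eq hR0 hd hne h0
  have hrR : r < R := hrρ.trans_lt hρR
  have hre : ∀ (T : ℝ) (w : ℂ), w ∈ Metric.ball (0 : ℂ) R → ‖h w‖ ≤ Real.exp T →
      (g w).re ≤ T := by
    intro T w hw hT
    rw [← hg w hw, Complex.norm_exp] at hT
    exact Real.exp_le_exp.mp hT
  have hga : ∀ w : ℂ, ‖w‖ = r / 2 → ‖g w‖ ≤ 2 * B := by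
    intro w hw
    refine (borelCaratheodory_zero hB (hgd.mono (Metric.ball_subset_ball hrR.le))
      (fun v hv => hre B v (Metric.ball_subset_ball hrR.le hv) (hsmall v hv)) hr
      (mem_ball_zero_iff.mpr (by linarith)) hg0).trans (le_of_eq ?_)
    rw [hw]
    field_simp
    ring
  have hgb : ∀ w : ℂ, ‖w‖ ≤ R₁ → ‖g w‖ ≤ C * M := by
    intro w hw
    refine (borelCaratheodory_zero hM hgd (fun v hv => hre M v hv (hbig v hv)) hR0
      (mem_ball_zero_iff.mpr (by linarith)) hg0).trans ?_
    rw [hC, div_mul_eq_mul_div]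
    refine div_le_div₀ (by positivity) ?_ (by linarith) (by linarith)
    nlinarith [mul_le_mul_of_nonneg_left hw hM.le]
  have hgρ : ∀ w : ℂ, ‖w‖ = ρ → ‖g w‖ ≤ K + η * M := by
    intro w hw
    have := norm_le_of_three_circles (r := r / 2) (by linarith) (by linarith) hR₁R hgd hga hgb
      (z := w) (by linarith) (by linarith)
    rw [hw, ← hθ, Real.mul_rpow hC0.le hM.le, ← mul_assoc] at this
    exact this.trans (hK M hM.le)
  have hgz : ‖g z‖ ≤ K + η * M := by
    refine Complex.norm_le_of_forall_mem_frontier_norm_le (U := Metric.ball (0 : ℂ) ρ)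
      Metric.isBounded_ball ?_ ?_ ?_
    · refine DifferentiableOn.diffContOnCl (hgd.mono ?_)
      rw [closure_ball _ hρ0.ne']
      exact Metric.closedBall_subset_ball hρR
    · intro w hw
      rw [frontier_ball _ hρ0.ne', mem_sphere_zero_iff_norm] at hw
      exact hgρ w hw
    · rw [closure_ball _ hρ0.ne', mem_closedBall_zero_iff]
      exact hz
  rw [← hg z (mem_ball_zero_iff.mpr (hz.trans_lt hρR)), Complex.norm_exp]
  exact Real.exp_le_exp.mpr ((Complex.re_le_norm _).trans hgz)

lemma norm_LSeries_le {f : ℕ → ℂ} {A : ℝ} (hA : 0 ≤ A) (hf : ∀ n, ‖f n‖ ≤ A) {s : ℂ}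
    (hs : 3 / 2 ≤ s.re) : ‖LSeries f s‖ ≤ A * ∑' n : ℕ, 1 / (n : ℝ) ^ (3 / 2 : ℝ) := by
  have hsum : Summable fun n : ℕ ↦ 1 / (n : ℝ) ^ (3 / 2 : ℝ) :=
    Real.summable_one_div_nat_rpow.mpr (by norm_num)
  refine tsum_of_norm_bounded (hsum.hasSum.mul_left A) fun n ↦ ?_
  rw [LSeries.norm_term_eq]
  split_ifs with hn
  · positivity
  · have h1 : (1 : ℝ) ≤ n := by exact_mod_cast Nat.one_le_iff_ne_zero.mpr hn
    rw [div_eq_mul_one_div]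
    gcongr
    · exact hf n

lemma one_le_tsum_one_div_rpow : (1 : ℝ) ≤ ∑' n : ℕ, 1 / (n : ℝ) ^ (3 / 2 : ℝ) := by
  have hsum : Summable fun n : ℕ ↦ 1 / (n : ℝ) ^ (3 / 2 : ℝ) :=
    Real.summable_one_div_nat_rpow.mpr (by norm_num)
  simpa using hsum.le_tsum 1 fun n _ ↦ by positivity

lemma exists_norm_LFunction_le_and_inv {q : ℕ} [NeZero q] (χ : DirichletCharacter ℂ q) :
    ∃ B : ℝ, 1 ≤ B ∧ ∀ s : ℂ, 3 / 2 ≤ s.re →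
      ‖DirichletCharacter.LFunction χ s‖ ≤ B ∧ ‖(DirichletCharacter.LFunction χ s)⁻¹‖ ≤ B := by
  refine ⟨_, one_le_tsum_one_div_rpow, fun s hs ↦ ?_⟩
  have hs1 : 1 < s.re := by linarith
  rw [DirichletCharacter.LFunction_eq_LSeries χ hs1]
  have hχ : ∀ n : ℕ, ‖χ (n : ZMod q)‖ ≤ 1 := fun n ↦ DirichletCharacter.norm_le_one χ _
  constructor
  · simpa using norm_LSeries_le zero_le_one hχ hs
  · have h1 := DirichletCharacter.LSeries.mul_mu_eq_one χ hs1
    rw [inv_eq_of_mul_eq_one_right h1]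
    refine (norm_LSeries_le zero_le_one (fun n ↦ ?_) hs).trans_eq (one_mul _)
    rw [Pi.mul_apply, norm_mul]
    refine mul_le_one₀ (hχ n) (norm_nonneg _) ?_
    rw [Complex.norm_intCast]
    exact_mod_cast ArithmeticFunction.abs_moebius_le_one

lemma exists_norm_LFunction_le_of_abs_im_le {N : ℕ} [NeZero N] (Φ : ZMod N → ℂ) (a T : ℝ) {b : ℝ}
    (hb : b < 1) : ∃ C : ℝ, 1 ≤ C ∧ ∀ s : ℂ, a ≤ s.re → s.re ≤ b → |s.im| ≤ T →
      ‖ZMod.LFunction Φ s‖ ≤ C := by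
  obtain ⟨C, hC⟩ := ((isCompact_Icc (a := a) (b := b)).reProdIm
    (isCompact_Icc (a := -T) (b := T))).exists_bound_of_continuousOn
    (f := ZMod.LFunction Φ) fun s hs ↦ by
      refine (ZMod.differentiableAt_LFunction Φ s (Or.inl ?_)).continuousAt.continuousWithinAt
      rintro rfl
      have := (Complex.mem_reProdIm.mp hs).1.2
      simp at this
      linarith
  exact ⟨max 1 C, le_max_left _ _, fun s h1 h2 h3 ↦
    (hC s (Complex.mem_reProdIm.mpr ⟨⟨h1, h2⟩, abs_le.mp h3⟩)).trans (le_max_right _ _)⟩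

/-- The Lindelöf hypothesis to the right of the critical line, under GRH. -/
lemma exists_norm_LFunction_le_rpow_of_ne_zero {q : ℕ} [NeZero q] (χ : DirichletCharacter ℂ q)
    (hχ : ∀ s : ℂ, 1 / 2 < s.re → s.re < 1 → DirichletCharacter.LFunction χ s ≠ 0)
    {δ ε : ℝ} (hδ : 0 < δ) (hδ1 : δ ≤ 1 / 4) (hε : 0 < ε) :
    ∃ C : ℝ, 1 ≤ C ∧ ∀ s : ℂ, 1 / 2 + δ ≤ s.re → s.re ≤ 3 / 4 →
      ‖DirichletCharacter.LFunction χ s‖ ≤ C * (1 + |s.im|) ^ ε := by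
  obtain ⟨B, hB1, hB⟩ := exists_norm_LFunction_le_and_inv χ
  obtain ⟨C₁, hC₁, hg⟩ := ZMod.exists_norm_LFunction_le (N := q) χ
  obtain ⟨C₀, hC₀, hs⟩ := exists_norm_LFunction_le_of_abs_im_le (N := q) χ (1 / 2 + δ) 3
    (b := 3 / 4) (by norm_num)
  obtain ⟨K, hK⟩ := exists_norm_le_exp_of_ne_zero (r := 1 / 2) (ρ := 3 / 2 - δ) (R := 3 / 2)
    (B := Real.log (2 * B ^ 2)) (η := ε) (by norm_num) (by linarith) (by linarith)
    (Real.log_pos (by nlinarith)) hε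
  set D : ℝ := 5 * C₁ * B with hD
  have hD5 : 5 ≤ D := by rw [hD]; nlinarith
  have hpow : ∀ t : ℝ, 1 ≤ (1 + |t|) ^ ε := fun t ↦
    Real.one_le_rpow (by linarith [abs_nonneg t]) hε.le
  refine ⟨max C₀ (B * (Real.exp K * D ^ ε)), hC₀.trans (le_max_left _ _), fun s h1 h2 ↦ ?_⟩
  rcases le_total |s.im| 3 with ht | ht
  · refine (hs s h1 (by linarith) ht).trans ?_
    calc C₀ ≤ max C₀ (B * (Real.exp K * D ^ ε)) * 1 := by rw [mul_one]; exact le_max_left _ _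
      _ ≤ _ := by
        gcongr
        exact hpow _
  · set z₀ : ℂ := ⟨2, s.im⟩ with hz₀
    have hB₀ := hB z₀ (by simp [hz₀]; norm_num)
    set L := DirichletCharacter.LFunction χ with hL
    have hball : ∀ z ∈ Metric.ball (0 : ℂ) (3 / 2), |z.re| < 3 / 2 ∧ |z.im| < 3 / 2 := by
      intro z hz
      rw [mem_ball_zero_iff] at hz
      exact ⟨(Complex.abs_re_le_norm z).trans_lt hz, (Complex.abs_im_le_norm z).trans_lt hz⟩
    have him : ∀ z ∈ Metric.ball (0 : ℂ) (3 / 2), 1 ≤ |(z₀ + z).im| := by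
      intro z hz
      have h3 := (hball z hz).2
      have h4 : |s.im| ≤ |(z₀ + z).im| + |z.im| := by
        have := abs_sub (z₀ + z).im z.im
        simpa [hz₀] using this
      linarith
    have hne1 : ∀ z ∈ Metric.ball (0 : ℂ) (3 / 2), z₀ + z ≠ 1 := by
      intro z hz h
      have := him z hz
      rw [h] at this
      norm_num at this
    have hre : ∀ z ∈ Metric.ball (0 : ℂ) (3 / 2), 1 / 2 < (z₀ + z).re := by
      intro z hz
      have := (abs_lt.mp (hball z hz).1).1
      simp [hz₀]
      linarith
    have hne : ∀ z ∈ Metric.ball (0 : ℂ) (3 / 2), L (z₀ + z) ≠ 0 := by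
      intro z hz
      rcases lt_or_ge (z₀ + z).re 1 with h | h
      · exact hχ _ (hre z hz) h
      · exact DirichletCharacter.LFunction_ne_zero_of_one_le_re χ (Or.inr (hne1 z hz)) h
    have h0 : L z₀ ≠ 0 := by simpa using hne 0 (by simp)
    have hM0 : 1 < D * (1 + |s.im|) := by nlinarith
    have key := hK (Real.log (D * (1 + |s.im|))) (fun z ↦ L (z₀ + z) / L z₀)
      (Real.log_pos hM0) ?_ (fun z hz ↦ div_ne_zero (hne z hz) h0) (by simp [h0]) ?_ ?_
      (s - z₀) ?_
    · simp only [add_sub_cancel] at key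
      have e1 : L s = L z₀ * (L s / L z₀) := by field_simp
      rw [e1, norm_mul]
      calc ‖L z₀‖ * ‖L s / L z₀‖
          ≤ B * Real.exp (K + ε * Real.log (D * (1 + |s.im|))) := by
            gcongr
            exact hB₀.1
        _ = B * (Real.exp K * D ^ ε) * (1 + |s.im|) ^ ε := by
            rw [Real.exp_add, mul_comm ε, ← Real.rpow_def_of_pos (by positivity),
              Real.mul_rpow (by positivity) (by positivity)]
            ring
        _ ≤ _ := by
            gcongr
            exact le_max_right _ _
    · intro z hz
      refine DifferentiableAt.differentiableWithinAt ?_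
      refine DifferentiableAt.div_const ?_ _
      exact (DirichletCharacter.differentiableAt_LFunction χ _ (Or.inl (hne1 z hz))).comp z
        (by fun_prop)
    · intro z hz
      rw [mem_ball_zero_iff] at hz
      have hre' := (abs_lt.mp ((Complex.abs_re_le_norm z).trans_lt hz)).1
      rw [Real.exp_log (by positivity), div_eq_mul_inv, norm_mul]
      have h5 := (hB (z₀ + z) (by simp [hz₀]; linarith)).1
      calc _ ≤ B * B := by
            gcongr
            exact hB₀.2
        _ ≤ _ := by nlinarith
    · intro z hz
      rw [Real.exp_log (by positivity), div_eq_mul_inv, norm_mul]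
      have h5 := hg (z₀ + z) (hre z hz).le (him z hz)
      have h6 : ‖z₀ + z‖ ≤ 5 * (1 + |s.im|) := by
        rw [mem_ball_zero_iff] at hz
        have := Complex.norm_le_abs_re_add_abs_im z₀
        have := norm_add_le z₀ z
        simp [hz₀] at *
        linarith [abs_nonneg s.im]
      calc _ ≤ (C₁ * (5 * (1 + |s.im|))) * B := by
            gcongr
            · exact h5.trans (by gcongr)
            · exact hB₀.2
        _ = _ := by rw [hD]; ring
    · have : s - z₀ = ((s.re - 2 : ℝ) : ℂ) := by
        apply Complex.ext <;> simp [hz₀]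
      rw [this, Complex.norm_real, Real.norm_eq_abs, abs_le]
      constructor <;> linarith

open scoped ZMod in
lemma ZMod.norm_LFunction_one_sub_le {N : ℕ} [NeZero N] (Φ : ZMod N → ℂ) {s : ℂ}
    (h1 : 1 / 2 ≤ s.re) (h2 : s.re ≤ 3 / 2) (hs : s ≠ 1) :
    ‖ZMod.LFunction Φ (1 - s)‖ ≤ N * ‖Gamma s‖ * Real.exp (Real.pi / 2 * |s.im|) *
      (‖ZMod.LFunction (𝓕 Φ) s‖ + ‖ZMod.LFunction (𝓕 fun x ↦ Φ (-x)) s‖) := by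
  have hN : (1 : ℝ) ≤ N := by exact_mod_cast Nat.one_le_iff_ne_zero.mpr (NeZero.ne N)
  rw [ZMod.LFunction_one_sub Φ (fun n hn ↦ ?_) (Or.inr hs)]
  · have e1 : ‖(N : ℂ) ^ (s - 1)‖ ≤ N := by
      rw [Complex.norm_natCast_cpow_of_pos (by exact_mod_cast hN)]
      calc (N : ℝ) ^ (s - 1).re ≤ (N : ℝ) ^ (1 : ℝ) :=
            Real.rpow_le_rpow_of_exponent_le hN (by simp; linarith)
        _ = N := Real.rpow_one _
    have e2 : ‖(2 * Real.pi : ℂ) ^ (-s)‖ ≤ 1 := by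
      have : (2 * Real.pi : ℂ) = ((2 * Real.pi : ℝ) : ℂ) := by push_cast; rfl
      rw [this, Complex.norm_cpow_eq_rpow_re_of_pos (by positivity)]
      exact Real.rpow_le_one_of_one_le_of_nonpos (by linarith [Real.pi_gt_three])
        (by simp; linarith)
    have e3 : ‖cexp (Real.pi * I * s / 2)‖ ≤ Real.exp (Real.pi / 2 * |s.im|) := by
      rw [Complex.norm_exp]
      gcongr
      have : (Real.pi * I * s / 2).re = Real.pi / 2 * (-s.im) := by
        simp; ring
      rw [this]
      gcongr
      exact neg_le_abs _
    have e4 : ‖cexp (-Real.pi * I * s / 2)‖ ≤ Real.exp (Real.pi / 2 * |s.im|) := by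
      rw [Complex.norm_exp]
      gcongr
      have : (-Real.pi * I * s / 2).re = Real.pi / 2 * s.im := by
        simp; ring
      rw [this]
      gcongr
      exact le_abs_self _
    rw [norm_mul, norm_mul, norm_mul]
    calc _ ≤ N * 1 * ‖Gamma s‖ * (Real.exp (Real.pi / 2 * |s.im|) * ‖ZMod.LFunction (𝓕 Φ) s‖ +
          Real.exp (Real.pi / 2 * |s.im|) * ‖ZMod.LFunction (𝓕 fun x ↦ Φ (-x)) s‖) := by
          refine mul_le_mul (by gcongr) ((norm_add_le _ _).trans ?_) (norm_nonneg _)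
            (by positivity)
          rw [norm_mul, norm_mul]
          gcongr
      _ = _ := by ring
  · rw [hn] at h1
    simp at h1
    linarith [(Nat.cast_nonneg n : (0 : ℝ) ≤ n)]

lemma norm_Gamma_one_half_add_mul_I_le (t : ℝ) :
    ‖Gamma (1 / 2 + t * I)‖ ≤ 3 * Real.exp (-(Real.pi / 2 * |t|)) := by
  have h := Complex.Gamma_mul_Gamma_one_sub (1 / 2 + t * I)
  have e1 : (1 - (1 / 2 + t * I) : ℂ) = (starRingEnd ℂ) (1 / 2 + t * I) := by
    apply Complex.ext
    · simp; norm_num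
    · simp
  have e2 : Complex.sin (Real.pi * (1 / 2 + t * I)) = (Real.cosh (Real.pi * t) : ℂ) := by
    rw [Complex.ofReal_cosh, ← Complex.cos_mul_I, ← Complex.sin_add_pi_div_two]
    congr 1
    push_cast
    ring
  rw [e1, Complex.Gamma_conj, Complex.mul_conj, e2] at h
  have h' : ‖Gamma (1 / 2 + t * I)‖ ^ 2 = Real.pi / Real.cosh (Real.pi * t) := by
    rw [← Complex.normSq_eq_norm_sq]
    exact_mod_cast h
  have hcosh : Real.exp (Real.pi * |t|) / 2 ≤ Real.cosh (Real.pi * t) := by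
    rw [← Real.cosh_abs, abs_mul, abs_of_pos Real.pi_pos, Real.cosh_eq]
    have := Real.exp_pos (-(Real.pi * |t|))
    linarith
  refine le_of_sq_le_sq ?_ (by positivity)
  rw [h', mul_pow, ← Real.exp_nat_mul, div_le_iff₀ (Real.cosh_pos _)]
  have e3 : ((2 : ℕ) : ℝ) * (-(Real.pi / 2 * |t|)) = -(Real.pi * |t|) := by push_cast; ring
  rw [e3, Real.exp_neg]
  calc Real.pi ≤ 3 ^ 2 * (Real.exp (Real.pi * |t|))⁻¹ * (Real.exp (Real.pi * |t|) / 2) := by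
        field_simp
        linarith [Real.pi_lt_four]
    _ ≤ _ := by gcongr

lemma norm_Gamma_le {s : ℂ} (hs : 0 < s.re) : ‖Gamma s‖ ≤ Real.Gamma s.re := by
  rw [Complex.Gamma_eq_integral hs, Real.Gamma_eq_integral hs, Complex.GammaIntegral]
  refine (MeasureTheory.norm_integral_le_integral_norm _).trans_eq ?_
  refine MeasureTheory.setIntegral_congr_fun measurableSet_Ioi fun x hx ↦ ?_
  simp only [norm_mul, Complex.norm_real, Real.norm_eq_abs]
  rw [Complex.norm_cpow_eq_rpow_re_of_pos hx, abs_of_pos (Real.exp_pos _)]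
  simp

lemma ZMod.exists_norm_LFunction_le_of_three_halves_le {N : ℕ} [NeZero N] (Φ : ZMod N → ℂ) :
    ∃ C : ℝ, 0 ≤ C ∧ ∀ s : ℂ, 3 / 2 ≤ s.re → ‖ZMod.LFunction Φ s‖ ≤ C := by
  refine ⟨(∑ j, ‖Φ j‖) * ∑' n : ℕ, 1 / (n : ℝ) ^ (3 / 2 : ℝ), by positivity, fun s hs ↦ ?_⟩
  rw [ZMod.LFunction_eq_LSeries Φ (by linarith)]
  exact norm_LSeries_le (by positivity)
    (fun n ↦ Finset.single_le_sum (f := fun j ↦ ‖Φ j‖) (fun _ _ ↦ norm_nonneg _)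
      (Finset.mem_univ _)) hs

open scoped ZMod in
lemma ZMod.exists_norm_LFunction_le_of_re_eq_neg_half {N : ℕ} [NeZero N] (Φ : ZMod N → ℂ) :
    ∃ C : ℝ, 1 ≤ C ∧ ∀ s : ℂ, s.re = -1 / 2 → ‖ZMod.LFunction Φ s‖ ≤ C * (1 + |s.im|) := by
  obtain ⟨A, hA0, hA⟩ := ZMod.exists_norm_LFunction_le_of_three_halves_le (𝓕 Φ)
  obtain ⟨B, hB0, hB⟩ :=
    ZMod.exists_norm_LFunction_le_of_three_halves_le (𝓕 fun x ↦ Φ (-x))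
  refine ⟨1 + N * 3 * (A + B), le_add_of_nonneg_right (by positivity), fun s hs ↦ ?_⟩
  have hre : (1 - s).re = 3 / 2 := by simp [hs]; norm_num
  have h1 := ZMod.norm_LFunction_one_sub_le Φ (s := 1 - s) (by linarith) (by linarith)
    (fun h ↦ by rw [h] at hre; norm_num at hre)
  rw [sub_sub_cancel] at h1
  have him : |(1 - s).im| = |s.im| := by simp
  have hG : ‖Gamma (1 - s)‖ ≤ (1 + |s.im|) * (3 * Real.exp (-(Real.pi / 2 * |s.im|))) := by
    have e : (1 - s : ℂ) = (1 / 2 + (-s.im : ℝ) * I) + 1 := by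
      apply Complex.ext
      · simp [hs]; norm_num
      · simp
    have hne : (1 / 2 + (-s.im : ℝ) * I : ℂ) ≠ 0 := fun h ↦ by
      have := congrArg Complex.re h
      norm_num at this
    rw [e, Complex.Gamma_add_one _ hne, norm_mul]
    have h2 := norm_Gamma_one_half_add_mul_I_le (-s.im)
    rw [abs_neg] at h2
    gcongr
    refine (Complex.norm_le_abs_re_add_abs_im _).trans ?_
    norm_num
  rw [him] at h1
  have hexp : Real.exp (-(Real.pi / 2 * |s.im|)) * Real.exp (Real.pi / 2 * |s.im|) = 1 := by
    rw [← Real.exp_add]; simp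
  calc _ ≤ _ := h1
    _ ≤ N * ((1 + |s.im|) * (3 * Real.exp (-(Real.pi / 2 * |s.im|)))) *
        Real.exp (Real.pi / 2 * |s.im|) * (A + B) := by
        gcongr
        · exact hA _ hre.ge
        · exact hB _ hre.ge
    _ = N * 3 * (A + B) * (1 + |s.im|) *
        (Real.exp (-(Real.pi / 2 * |s.im|)) * Real.exp (Real.pi / 2 * |s.im|)) := by ring
    _ = N * 3 * (A + B) * (1 + |s.im|) := by rw [hexp, mul_one]
    _ ≤ _ := by gcongr; linarith

lemma exists_norm_Gamma_le : ∃ G : ℝ, 0 ≤ G ∧ ∀ s : ℂ, 1 / 2 ≤ s.re → s.re ≤ 3 / 2 →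
    ‖Gamma s‖ ≤ G := by
  obtain ⟨G, hG⟩ := (isCompact_Icc (a := (1 / 2 : ℝ)) (b := 3 / 2)).exists_bound_of_continuousOn
    (f := Real.Gamma) fun x hx ↦
      (Real.differentiableAt_Gamma fun m ↦ by
        have := hx.1
        have : (0 : ℝ) ≤ m := Nat.cast_nonneg m
        linarith).continuousAt.continuousWithinAt
  refine ⟨G, (norm_nonneg _).trans (hG 1 (by constructor <;> norm_num)), fun s h1 h2 ↦ ?_⟩
  exact (norm_Gamma_le (by linarith)).trans ((le_abs_self _).trans (hG _ ⟨h1, h2⟩))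

open scoped ZMod in
lemma ZMod.exists_norm_LFunction_le_exp {N : ℕ} [NeZero N] (Φ : ZMod N → ℂ) :
    ∃ C : ℝ, 1 ≤ C ∧ ∀ s : ℂ, -1 / 2 ≤ s.re → s.re ≤ 3 / 4 →
      ‖ZMod.LFunction Φ s‖ ≤ C * Real.exp (3 * |s.im|) := by
  obtain ⟨G, hG0, hG⟩ := exists_norm_Gamma_le
  obtain ⟨C₀, hC₀1, hC₀⟩ := ZMod.exists_norm_LFunction_le Φ
  obtain ⟨A, hA1, hA⟩ := ZMod.exists_norm_LFunction_le (𝓕 Φ)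
  obtain ⟨B, hB1, hB⟩ := ZMod.exists_norm_LFunction_le (𝓕 fun x ↦ Φ (-x))
  obtain ⟨C₁, hC₁1, hC₁⟩ := exists_norm_LFunction_le_of_abs_im_le Φ (-1 / 2) 1 (b := 3 / 4)
    (by norm_num)
  refine ⟨C₁ + C₀ * 2 + N * G * (A + B) * 2, ?_, fun s h1 h2 ↦ ?_⟩
  · have : 0 ≤ N * G * (A + B) * 2 := by positivity
    linarith
  have hexp1 : 1 ≤ Real.exp (3 * |s.im|) := Real.one_le_exp (by positivity)
  have hlin : ∀ w : ℂ, |w.re| ≤ 3 / 2 → |w.im| = |s.im| → ‖w‖ ≤ 2 * Real.exp |s.im| := by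
    intro w hw hw'
    have := Complex.norm_le_abs_re_add_abs_im w
    have := Real.add_one_le_exp |s.im|
    linarith [abs_nonneg s.im]
  rcases le_total |s.im| 1 with ht | ht
  · calc _ ≤ C₁ := hC₁ s h1 h2 ht
      _ ≤ C₁ * Real.exp (3 * |s.im|) := le_mul_of_one_le_right (by linarith) hexp1
      _ ≤ _ := by
        gcongr
        have : 0 ≤ N * G * (A + B) * 2 := by positivity
        linarith
  rcases le_total (1 / 2) s.re with hr | hr
  · calc _ ≤ C₀ * ‖s‖ := hC₀ s hr ht
      _ ≤ C₀ * (2 * Real.exp |s.im|) := by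
        gcongr
        exact hlin s (abs_le.mpr (by constructor <;> linarith)) rfl
      _ ≤ C₀ * (2 * Real.exp (3 * |s.im|)) := by
        gcongr
        linarith
      _ = C₀ * 2 * Real.exp (3 * |s.im|) := by ring
      _ ≤ _ := by
        gcongr
        have : 0 ≤ N * G * (A + B) * 2 := by positivity
        linarith
  · have him : |(1 - s).im| = |s.im| := by simp
    have hre : (1 - s).re = 1 - s.re := by simp
    have h3 := ZMod.norm_LFunction_one_sub_le Φ (s := 1 - s) (by linarith) (by linarith)
      (fun h ↦ by rw [h] at him; simp at him; rw [← him] at ht; norm_num at ht)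
    rw [sub_sub_cancel, him] at h3
    have hw := hlin (1 - s) (by rw [hre, abs_le]; constructor <;> linarith) him
    calc _ ≤ _ := h3
      _ ≤ N * G * Real.exp (Real.pi / 2 * |s.im|) *
          (A * (2 * Real.exp |s.im|) + B * (2 * Real.exp |s.im|)) := by
          gcongr
          · exact hG _ (by linarith) (by linarith)
          · exact (hA _ (by linarith) (him ▸ ht)).trans (by gcongr)
          · exact (hB _ (by linarith) (him ▸ ht)).trans (by gcongr)
      _ = N * G * (A + B) * 2 * Real.exp (Real.pi / 2 * |s.im| + |s.im|) := by
          rw [Real.exp_add]; ring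
      _ ≤ N * G * (A + B) * 2 * Real.exp (3 * |s.im|) := by
          gcongr
          nlinarith [Real.pi_lt_four]
      _ ≤ _ := by gcongr; linarith

lemma norm_cexp_sub_mul_I_sq (z : ℂ) (t : ℝ) :
    ‖cexp ((z - t * I) ^ 2)‖ = Real.exp (z.re ^ 2 - (z.im - t) ^ 2) := by
  rw [Complex.norm_exp]
  congr 1
  simp [sq]

lemma one_add_abs_le_mul (a b : ℝ) : 1 + |a| ≤ (1 + |b|) * (1 + |a - b|) := by
  have := abs_sub_abs_le_abs_sub a b
  nlinarith [mul_nonneg (abs_nonneg b) (abs_nonneg (a - b))]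

/-- A convexity bound of Phragmén–Lindelöf type in the strip `-1/2 ≤ Re s ≤ 1/2 + δ`. -/
lemma exists_norm_le_rpow_of_strip {L : ℂ → ℂ} {A B E c δ ε : ℝ} (hA : 1 ≤ A) (hc : 0 ≤ c)
    (hc1 : c ≤ 1) (hδ : 0 < δ) (hδ1 : δ ≤ 1 / 4) (hε : 0 < ε) (hε1 : ε ≤ 1)
    (hL : ∀ s : ℂ, s.re < 1 → DifferentiableAt ℂ L s)
    (hl : ∀ s : ℂ, s.re = -1 / 2 → ‖L s‖ ≤ A * (1 + |s.im|))
    (hu : ∀ s : ℂ, s.re = 1 / 2 + δ → ‖L s‖ ≤ B * (1 + |s.im|) ^ ε)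
    (hE : ∀ s : ℂ, -1 / 2 ≤ s.re → s.re ≤ 3 / 4 → ‖L s‖ ≤ E * Real.exp (3 * |s.im|)) :
    ∃ C : ℝ, 1 ≤ C ∧ ∀ s : ℂ, 1 / 2 - c ≤ s.re → s.re ≤ 1 / 2 + δ →
      ‖L s‖ ≤ C * (1 + |s.im|) ^ (c + δ + ε) := by
  set Q : ℝ := max A B * Real.exp 2 with hQ
  have hmax : 1 ≤ max A B := hA.trans (le_max_left _ _)
  have hQ1 : 1 ≤ Q := one_le_mul_of_one_le_of_one_le hmax (Real.one_le_exp (by norm_num))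
  refine ⟨Q, hQ1, fun s h1 h2 ↦ ?_⟩
  set T : ℝ := 1 + |s.im| with hT
  have hT1 : 1 ≤ T := le_add_of_nonneg_right (abs_nonneg _)
  set f : ℂ → ℂ := fun z ↦ L z * cexp ((z - s.im * I) ^ 2) with hf
  have hfn : ∀ z, ‖f z‖ = ‖L z‖ * Real.exp (z.re ^ 2 - (z.im - s.im) ^ 2) := fun z ↦ by
    rw [hf, norm_mul, norm_cexp_sub_mul_I_sq]
  have hE0 : 0 ≤ E := by
    have h0 := (norm_nonneg _).trans (hE 0 (by norm_num) (by norm_num))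
    simpa using h0
  have hgauss : ∀ z : ℂ, z.re ^ 2 ≤ 1 →
      (1 + |z.im - s.im|) * Real.exp (z.re ^ 2 - (z.im - s.im) ^ 2) ≤ Real.exp 2 := by
    intro z hz
    have e1 := Real.add_one_le_exp |z.im - s.im|
    calc _ ≤ Real.exp |z.im - s.im| * Real.exp (z.re ^ 2 - (z.im - s.im) ^ 2) := by
          gcongr; linarith
      _ ≤ _ := by
          rw [← Real.exp_add]
          gcongr
          nlinarith [sq_nonneg (|z.im - s.im| - 1 / 2), sq_abs (z.im - s.im)]
  have hdiff : DiffContOnCl ℂ f (HadamardThreeLines.verticalStrip (-1 / 2) (1 / 2 + δ)) := by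
    refine DifferentiableOn.diffContOnCl fun z hz ↦ DifferentiableAt.differentiableWithinAt ?_
    have hz' : z ∈ re ⁻¹' Set.Icc (-1 / 2) (1 / 2 + δ) :=
      closure_minimal (Set.preimage_mono Set.Ioo_subset_Icc_self)
        (isClosed_Icc.preimage continuous_re) hz
    exact (hL z (by linarith [hz'.2])).mul (by fun_prop)
  have hbdd : BddAbove ((norm ∘ f) ''
      HadamardThreeLines.verticalClosedStrip (-1 / 2) (1 / 2 + δ)) := by
    refine ⟨E * Real.exp (3 * |s.im| + 4), ?_⟩
    rintro _ ⟨z, hz, rfl⟩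
    have hz1 : -1 / 2 ≤ z.re := hz.1
    have hz2 : z.re ≤ 1 / 2 + δ := hz.2
    rw [Function.comp_apply, hfn]
    calc _ ≤ E * Real.exp (3 * |z.im|) * Real.exp (z.re ^ 2 - (z.im - s.im) ^ 2) := by
          gcongr
          exact hE z hz1 (by linarith)
      _ = E * Real.exp (3 * |z.im| + (z.re ^ 2 - (z.im - s.im) ^ 2)) := by
          rw [Real.exp_add, mul_assoc]
      _ ≤ _ := by
          refine mul_le_mul_of_nonneg_left (Real.exp_le_exp.mpr ?_) hE0
          have hre : z.re ^ 2 ≤ 1 := by nlinarith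
          have := abs_sub_abs_le_abs_sub z.im s.im
          nlinarith [sq_nonneg (|z.im - s.im| - 3 / 2), sq_abs (z.im - s.im)]
  have hleft : ∀ z ∈ re ⁻¹' {(-1 / 2 : ℝ)}, ‖f z‖ ≤ Q * T := by
    intro z hz
    have hz1 : z.re = -1 / 2 := hz
    rw [hfn]
    calc _ ≤ max A B * (T * (1 + |z.im - s.im|)) *
            Real.exp (z.re ^ 2 - (z.im - s.im) ^ 2) := by
          gcongr
          refine (hl z hz1).trans ?_
          gcongr
          · exact le_max_left _ _
          · exact one_add_abs_le_mul _ _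
      _ = max A B * T * ((1 + |z.im - s.im|) *
            Real.exp (z.re ^ 2 - (z.im - s.im) ^ 2)) := by ring
      _ ≤ max A B * T * Real.exp 2 := by
          gcongr
          exact hgauss z (by rw [hz1]; norm_num)
      _ = Q * T := by rw [hQ]; ring
  have hright : ∀ z ∈ re ⁻¹' {(1 / 2 + δ : ℝ)}, ‖f z‖ ≤ Q * T ^ ε := by
    intro z hz
    have hz1 : z.re = 1 / 2 + δ := hz
    rw [hfn]
    calc _ ≤ max A B * (T ^ ε * (1 + |z.im - s.im|)) *
            Real.exp (z.re ^ 2 - (z.im - s.im) ^ 2) := by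
          gcongr
          refine (hu z hz1).trans ?_
          gcongr
          · exact le_max_right _ _
          · calc (1 + |z.im|) ^ ε ≤ (T * (1 + |z.im - s.im|)) ^ ε := by
                  gcongr
                  exact one_add_abs_le_mul _ _
              _ = T ^ ε * (1 + |z.im - s.im|) ^ ε := Real.mul_rpow (by positivity) (by positivity)
              _ ≤ T ^ ε * (1 + |z.im - s.im|) ^ (1 : ℝ) := by
                  gcongr
                  exact le_add_of_nonneg_right (abs_nonneg _)
              _ = _ := by rw [Real.rpow_one]
      _ = max A B * T ^ ε * ((1 + |z.im - s.im|) *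
            Real.exp (z.re ^ 2 - (z.im - s.im) ^ 2)) := by ring
      _ ≤ max A B * T ^ ε * Real.exp 2 := by
          gcongr
          exact hgauss z (by rw [hz1]; nlinarith)
      _ = Q * T ^ ε := by rw [hQ]; ring
  have key := HadamardThreeLines.norm_le_interp_of_mem_verticalClosedStrip' (z := s)
    (by linarith) ⟨by linarith, h2⟩ hdiff hbdd hleft hright
  set θ : ℝ := (s.re - -1 / 2) / (1 / 2 + δ - -1 / 2) with hθ
  have hθ1 : 1 - θ ≤ c + δ := by
    have : 1 - θ = (1 / 2 + δ - s.re) / (1 + δ) := by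
      rw [hθ]
      have : (1 / 2 + δ - -1 / 2) = 1 + δ := by ring
      rw [this]
      field_simp
      ring
    rw [this, div_le_iff₀ (by linarith)]
    nlinarith
  have hθ2 : θ ≤ 1 := by
    rw [hθ, div_le_one (by linarith)]
    linarith
  calc ‖L s‖ ≤ ‖f s‖ := by
        rw [hfn]
        refine le_mul_of_one_le_right (norm_nonneg _) (Real.one_le_exp ?_)
        rw [sub_self]
        nlinarith [sq_nonneg s.re]
    _ ≤ _ := key
    _ = Q * T ^ ((1 - θ) + ε * θ) := by
        rw [Real.mul_rpow (x := Q) (y := T) (by positivity) (by positivity),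
          Real.mul_rpow (x := Q) (by positivity) (by positivity), ← Real.rpow_mul (by positivity),
          Real.rpow_add (by positivity)]
        have : Q ^ (1 - θ) * Q ^ θ = Q := by
          rw [← Real.rpow_add (by positivity)]
          simp
        calc _ = Q ^ (1 - θ) * Q ^ θ * (T ^ (1 - θ) * T ^ (ε * θ)) := by ring
          _ = _ := by rw [this]
    _ ≤ _ := by
        gcongr
        exact mul_le_of_le_one_right hε.le hθ2

/-- A function vanishing at the centre of a disk is bounded by its maximum on the boundary circle,
even after division by the corresponding linear factor. -/
lemma norm_div_sub_le_of_sphere {L : ℂ → ℂ} {w : ℂ} {c A : ℝ} (hc : 0 < c)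
    (hL : ∀ z, ‖z - w‖ ≤ c → DifferentiableAt ℂ L z) (hw : L w = 0)
    (hA : ∀ z, ‖z - w‖ = c → ‖L z‖ ≤ A) {s : ℂ} (hs : ‖s - w‖ ≤ c) (hsw : s ≠ w) :
    ‖L s / (s - w)‖ ≤ A / c := by
  have hd : DifferentiableOn ℂ (dslope L w) (Metric.closedBall w c) := by
    rw [differentiableOn_dslope (Metric.closedBall_mem_nhds w hc)]
    exact fun z hz ↦ (hL z (by rwa [← mem_closedBall_iff_norm])).differentiableWithinAt
  have heq : ∀ z, z ≠ w → dslope L w z = L z / (z - w) := fun z hz ↦ by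
    rw [dslope_of_ne L hz, slope_def_field, hw, sub_zero]
  rw [← heq s hsw]
  refine norm_le_of_forall_mem_frontier_norm_le (Metric.isBounded_ball (x := w) (r := c))
    (DifferentiableOn.diffContOnCl (by rwa [closure_ball w hc.ne'])) (fun z hz ↦ ?_) ?_
  · rw [frontier_ball w hc.ne', mem_sphere_iff_norm] at hz
    rw [heq z (fun h ↦ by rw [h, sub_self, norm_zero] at hz; exact hc.ne hz), norm_div, hz]
    gcongr
    exact hA z hz
  · rwa [closure_ball w hc.ne', mem_closedBall_iff_norm]

/-- Growth of `L(s,χ)` near the critical line, for `χ` without zeros in `1/2 < Re s < 1`. -/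
lemma exists_norm_LFunction_le_rpow {q : ℕ} [NeZero q] (χ : DirichletCharacter ℂ q)
    (hχ : ∀ s : ℂ, 1 / 2 < s.re → s.re < 1 → DirichletCharacter.LFunction χ s ≠ 0)
    {c ε : ℝ} (hc : 0 ≤ c) (hc1 : c ≤ 1 / 4) (hε : 0 < ε) :
    ∃ C : ℝ, 1 ≤ C ∧ ∀ s : ℂ, 1 / 2 - c ≤ s.re → s.re ≤ 1 / 2 + c →
      ‖DirichletCharacter.LFunction χ s‖ ≤ C * (1 + |s.im|) ^ (c + ε) := by
  have hδ : 0 < min (ε / 2) (1 / 4) := by positivity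
  have hη : 0 < min (ε / 2) 1 := by positivity
  obtain ⟨B, hB1, hB⟩ := exists_norm_LFunction_le_rpow_of_ne_zero χ hχ hδ (min_le_right _ _) hη
  obtain ⟨A, hA1, hA⟩ := ZMod.exists_norm_LFunction_le_of_re_eq_neg_half (N := q) χ
  obtain ⟨E, -, hE⟩ := ZMod.exists_norm_LFunction_le_exp (N := q) χ
  obtain ⟨C, hC1, hC⟩ := exists_norm_le_rpow_of_strip (L := DirichletCharacter.LFunction χ)
    hA1 hc (by linarith) hδ (min_le_right _ _) hη (min_le_right _ _)
    (fun s hs ↦ DirichletCharacter.differentiableAt_LFunction χ s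
      (Or.inl fun h ↦ by simp [h] at hs))
    hA (fun s hs ↦ hB s hs.ge (by linarith [min_le_right (ε / 2) (1 / 4)])) hE
  refine ⟨max B C, hB1.trans (le_max_left _ _), fun s h1 h2 ↦ ?_⟩
  have hT : 1 ≤ 1 + |s.im| := le_add_of_nonneg_right (abs_nonneg _)
  have hη2 := min_le_left (ε / 2) 1
  have hδ2 := min_le_left (ε / 2) (1 / 4)
  rcases le_total s.re (1 / 2 + min (ε / 2) (1 / 4)) with h | h
  · refine (hC s h1 h).trans ?_
    exact mul_le_mul (le_max_right _ _) (Real.rpow_le_rpow_of_exponent_le hT (by linarith))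
      (by positivity) (by positivity)
  · refine (hB s h (by linarith)).trans ?_
    exact mul_le_mul (le_max_left _ _) (Real.rpow_le_rpow_of_exponent_le hT (by linarith))
      (by positivity) (by positivity)

/-- **Lemma 4.1:** bound for `L(s,χ)/(s-ρ)` on the truncated Hankel contour around a
non-trivial zero `ρ = 1/2 + iγ`. -/
theorem L_over_linear_on_hankel_bound
    (q : ℕ) (hq : 0 < q) (χ : DirichletCharacter ℂ q) (hGRH : GRH χ)
    (c : ℝ) (hc0 : 0 < c) (hc1 : c < 1 / 8) (ε : ℝ) (hε : 0 < ε) :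
    ∃ C : ℝ, ∀ γ : ℝ, LVal χ (1 / 2 + γ * I) = 0 →
      ∃ r₀ : ℝ, 0 < r₀ ∧ ∀ r : ℝ, 0 < r → r < r₀ →
        ∀ s : ℂ,
          ((s.im = γ ∧ 1 / 2 - c ≤ s.re ∧ s.re ≤ 1 / 2 - r) ∨ ‖s - (1 / 2 + γ * I)‖ = r) →
          ‖LVal χ s / (s - (1 / 2 + γ * I))‖ ≤ C * (|γ| + 1) ^ (c + ε) := by
  have : NeZero q := ⟨hq.ne'⟩
  have hLV : LVal χ = DirichletCharacter.LFunction χ := funext fun s ↦ dif_neg hq.ne'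
  have hχ : ∀ s : ℂ, 1 / 2 < s.re → s.re < 1 → DirichletCharacter.LFunction χ s ≠ 0 :=
    fun s h1 h2 h3 ↦ h1.ne' (hGRH s (by linarith) h2 (by rw [hLV, h3]))
  rw [hLV]
  obtain ⟨C, hC1, hC⟩ := exists_norm_LFunction_le_rpow χ hχ hc0.le (by linarith) hε
  refine ⟨C * 2 ^ (c + ε) / c, fun γ hγ ↦ ⟨c, hc0, fun r hr0 hrc s hs ↦ ?_⟩⟩
  set ρ : ℂ := 1 / 2 + γ * I with hρ
  have hre : ρ.re = 1 / 2 := by simp [hρ]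
  have him : ρ.im = γ := by simp [hρ]
  have hdisk : ‖s - ρ‖ ≤ c ∧ s ≠ ρ := by
    rcases hs with ⟨h1, h2, h3⟩ | h
    · have e : s - ρ = ((s.re - 1 / 2 : ℝ) : ℂ) := by
        apply Complex.ext <;> simp [hρ, h1]
      constructor
      · rw [e, Complex.norm_real, Real.norm_eq_abs, abs_le]
        constructor <;> linarith
      · rintro rfl
        linarith
    · refine ⟨h.trans_le hrc.le, ?_⟩
      rintro rfl
      rw [sub_self, norm_zero] at h
      exact hr0.ne h
  have hbox : ∀ z : ℂ, ‖z - ρ‖ ≤ c → |z.re - 1 / 2| ≤ c ∧ |z.im - γ| ≤ c := fun z hz ↦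
    ⟨by simpa [hre] using (Complex.abs_re_le_norm (z - ρ)).trans hz,
      by simpa [him] using (Complex.abs_im_le_norm (z - ρ)).trans hz⟩
  refine (norm_div_sub_le_of_sphere hc0 (A := C * (2 * (|γ| + 1)) ^ (c + ε)) (fun z hz ↦ ?_) hγ
    (fun z hz ↦ ?_) hdisk.1 hdisk.2).trans_eq ?_
  · refine DirichletCharacter.differentiableAt_LFunction χ z (Or.inl ?_)
    rintro rfl
    have := (abs_le.mp (hbox 1 hz).1).2
    norm_num at this
    linarith
  · obtain ⟨h1, h2⟩ := hbox z hz.le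
    rw [abs_le] at h1
    refine (hC z (by linarith) (by linarith)).trans ?_
    gcongr
    have := abs_sub_abs_le_abs_sub z.im γ
    linarith [abs_nonneg γ]
  · rw [Real.mul_rpow (by norm_num) (by positivity)]
    ring

end
end
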